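/- arXiv:2502.09353 — 4 statements merged into one kernel-verified Lean document; each statement's English description precedes it below -/
import Mathlib

section
/- (Discrete Umlaufsatz: the turning number of a simple closed polygon is ±1.) Let n ≥ 3 and let C : ZMod n → EuclideanSpace ℝ (Fin 2) be a closed polygon with C(i+1) ≠ C(i) for all i, which is simple in the following sense: for all i ≠ j, the closed segments [C(i), C(i+1)] and [C(j), C(j+1)] intersect exactly in {C(i+1)} if j = i+1, exactly in {C(i)} if j = i−1, and are disjoint otherwise. Then ∑_{i ∈ ZMod n} θ_i = 2π or ∑_{i ∈ ZMod n} θ_i = −2π, where θ_i ∈ (−π, π) is the real representative of the oriented angle from e_{i−1} = C(i) − C(i−1) to e_i = C(i+1) − C(i) with respect to the standard orientation of ℝ². -/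
open scoped RealInnerProductSpace

noncomputable instance : Fact (Module.finrank ℝ (EuclideanSpace ℝ (Fin 2)) = 2) :=
  ⟨finrank_euclideanSpace_fin⟩

/-- The standard orientation of the Euclidean plane. -/
noncomputable def stdOrientation : Orientation ℝ (EuclideanSpace ℝ (Fin 2)) (Fin 2) :=
  (EuclideanSpace.basisFun (Fin 2) ℝ).toBasis.orientation

/-- abbreviation: the plane -/
abbrev UPlane := EuclideanSpace ℝ (Fin 2)

/-- signed real angle -/
noncomputable def uA (u v : UPlane) : ℝ := (stdOrientation.oangle u v).toReal

lemma uA_half_aux {p u : UPlane} (hu : 0 < inner ℝ p u) : |uA p u| < Real.pi / 2 := by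
  have h := stdOrientation.inner_eq_norm_mul_norm_mul_cos_oangle p u
  rw [h] at hu
  have h2 : 0 < Real.Angle.cos (stdOrientation.oangle p u) := by
    by_contra hc
    push Not at hc
    have : 0 ≤ ‖p‖ * ‖u‖ := by positivity
    nlinarith
  exact Real.Angle.cos_pos_iff_abs_toReal_lt_pi_div_two.mp h2

lemma uA_half {p u v : UPlane} (hu : 0 < inner ℝ p u) (hv : 0 < inner ℝ p v) :
    uA u v = uA p v - uA p u := by
  have hp0 : p ≠ 0 := by rintro rfl; simp at hu
  have hu0 : u ≠ 0 := by rintro rfl; simp at hu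
  have hv0 : v ≠ 0 := by rintro rfl; simp at hv
  have h1 := abs_lt.mp (uA_half_aux hu)
  have h2 := abs_lt.mp (uA_half_aux hv)
  have h3 : stdOrientation.oangle u v = ((uA p v - uA p u : ℝ) : Real.Angle) := by
    rw [Real.Angle.coe_sub]
    simp only [uA, Real.Angle.coe_toReal]
    rw [stdOrientation.oangle_sub_left hp0 hu0 hv0]
  have h4 := Real.Angle.toReal_coe_eq_self_iff.mpr
    (⟨by linarith, by linarith⟩ : -Real.pi < uA p v - uA p u ∧ uA p v - uA p u ≤ Real.pi)
  rw [← h4, ← h3]; rfl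

lemma uA_add {p u v w : UPlane} (hu : 0 < inner ℝ p u) (hv : 0 < inner ℝ p v)
    (hw : 0 < inner ℝ p w) : uA u v + uA v w = uA u w := by
  rw [uA_half hu hv, uA_half hv hw, uA_half hu hw]; ring

lemma uA_neg_neg (u v : UPlane) : uA (-u) (-v) = uA u v := by
  simp [uA, stdOrientation.oangle_neg_neg]

lemma uA_tele {p : UPlane} (f : ℕ → UPlane) (m : ℕ) (N : ℕ) (hN : m ≤ N)
    (h : ∀ j, m ≤ j → j ≤ N → 0 < inner ℝ p (f j)) :
    ∑ j ∈ Finset.Ico m N, uA (f j) (f (j + 1)) = uA (f m) (f N) := by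
  induction N, hN using Nat.le_induction with
  | base => simp [uA]
  | succ N hN ih =>
    rw [Finset.sum_Ico_succ_top hN, ih (fun j h1 h2 => h j h1 (by omega))]
    exact uA_add (h _ le_rfl (by omega)) (h _ hN (by omega)) (h _ (by omega) le_rfl)

/-- `a → b → -a` turns by `±π`. -/
lemma uA_pi {a b : UPlane} (ha : a ≠ 0) (hb : b ≠ 0) :
    uA a b + uA b (-a) = Real.pi ∨ uA a b + uA b (-a) = -Real.pi := by
  have h : ((uA a b + uA b (-a) : ℝ) : Real.Angle) = (Real.pi : ℝ) := by
    rw [Real.Angle.coe_add]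
    simp only [uA, Real.Angle.coe_toReal]
    rw [stdOrientation.oangle_add ha hb (neg_ne_zero.mpr ha), stdOrientation.oangle_neg_right ha ha, stdOrientation.oangle_self, zero_add]
  obtain ⟨k, hk⟩ := Real.Angle.angle_eq_iff_two_pi_dvd_sub.mp h
  have h1 := Real.Angle.neg_pi_lt_toReal (stdOrientation.oangle a b)
  have h2 := Real.Angle.toReal_le_pi (stdOrientation.oangle a b)
  have h3 := Real.Angle.neg_pi_lt_toReal (stdOrientation.oangle b (-a))
  have h4 := Real.Angle.toReal_le_pi (stdOrientation.oangle b (-a))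
  change -Real.pi < uA a b at h1
  change uA a b ≤ Real.pi at h2
  change -Real.pi < uA b (-a) at h3
  change uA b (-a) ≤ Real.pi at h4
  have hpi := Real.pi_pos
  have k1 : k < 1 := by
    by_contra hc
    have : (1 : ℝ) ≤ k := by exact_mod_cast not_lt.mp hc
    nlinarith
  have k2 : -2 < k := by
    by_contra hc
    have : (k : ℝ) ≤ -2 := by exact_mod_cast not_lt.mp hc
    nlinarith
  have : k = 0 ∨ k = -1 := by omega
  rcases this with rfl | rfl
  · left; push_cast at hk; linarith
  · right; push_cast at hk; linarith

lemma u_sep {s t : Set UPlane} (hs : Convex ℝ s) (hs' : IsCompact s) (ht : Convex ℝ t)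
    (ht' : IsClosed t) (hd : Disjoint s t) :
    ∃ p : UPlane, ∀ a ∈ s, ∀ b ∈ t, 0 < inner ℝ p (b - a) := by
  obtain ⟨f, u, v, h1, h2, h3⟩ := geometric_hahn_banach_compact_closed hs hs' ht ht' hd
  refine ⟨(InnerProductSpace.toDual ℝ UPlane).symm f, fun a ha b hb => ?_⟩
  rw [InnerProductSpace.toDual_symm_apply, map_sub]
  linarith [h1 a ha, h3 b hb]

lemma u_segment_compact (x y : UPlane) : IsCompact (segment ℝ x y) := by
  rw [← convexHull_pair (𝕜 := ℝ)]
  exact (Set.toFinite {x, y}).isCompact_convexHull ℝ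

lemma u_tri {a b c : UPlane} (hab : b ≠ a) (hbc : c ≠ b)
    (h : segment ℝ a b ∩ segment ℝ b c = {b}) :
    ∃ p : UPlane, 0 < inner ℝ p (b - a) ∧ 0 < inner ℝ p (c - b) := by
  have hd : Disjoint ({0} : Set UPlane) (segment ℝ (b - a) (c - b)) := by
    rw [Set.disjoint_singleton_left]
    rintro ⟨s, t, hs, ht, hst, h0⟩
    have h1 : b - s • (b - a) ∈ segment ℝ a b :=
      ⟨s, 1 - s, hs, by linarith, by ring, by module⟩
    have h2 : b - s • (b - a) ∈ segment ℝ b c := by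
      refine ⟨1 - t, t, by linarith, ht, by ring, ?_⟩
      have : t • (c - b) = - (s • (b - a)) := by
        rw [eq_neg_iff_add_eq_zero, add_comm]; exact h0
      have h4 : (1 - t) • b + t • c = b + t • (c - b) := by module
      rw [h4, this]; abel
    have h3 : b - s • (b - a) ∈ ({b} : Set UPlane) := h ▸ ⟨h1, h2⟩
    have h4 : s • (b - a) = 0 := by simpa using h3
    rw [smul_eq_zero] at h4
    rcases h4 with h4 | h4
    · subst h4
      have : t = 1 := by linarith
      subst this
      simp at h0
      exact hbc (sub_eq_zero.mp h0)
    · exact hab (sub_eq_zero.mp h4)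
  obtain ⟨p, hp⟩ := u_sep (convex_singleton 0) isCompact_singleton (convex_segment _ _)
    (u_segment_compact (b - a) (c - b)).isClosed hd
  refine ⟨p, ?_, ?_⟩
  · simpa using hp 0 rfl _ (left_mem_segment ℝ _ _)
  · simpa using hp 0 rfl _ (right_mem_segment ℝ _ _)

/-- triangle additivity -/
lemma uA_tri {a b c : UPlane}
    (h : ∃ p : UPlane, 0 < inner ℝ p (b - a) ∧ 0 < inner ℝ p (c - b)) :
    uA (b - a) (c - a) + uA (c - a) (c - b) = uA (b - a) (c - b) := by
  obtain ⟨p, h1, h2⟩ := h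
  refine uA_add h1 ?_ h2
  have : c - a = (b - a) + (c - b) := by abel
  rw [this, inner_add_right]; linarith

lemma uA_cell {a b c d : UPlane} (h : Disjoint (segment ℝ a b) (segment ℝ c d)) :
    uA (c - a) (c - b) + uA (c - b) (d - b) = uA (c - a) (d - a) + uA (d - a) (d - b) := by
  obtain ⟨p, hp⟩ := u_sep (convex_segment a b) (u_segment_compact a b) (convex_segment c d)
    (u_segment_compact c d).isClosed h
  have ha := left_mem_segment ℝ a b
  have hb := right_mem_segment ℝ a b
  have hc := left_mem_segment ℝ c d
  have hd := right_mem_segment ℝ c d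
  rw [uA_add (hp _ ha _ hc) (hp _ hb _ hc) (hp _ hb _ hd),
    uA_add (hp _ ha _ hc) (hp _ ha _ hd) (hp _ hb _ hd)]

/-- Column step: pushing the column `k+1` to the column `k+2`. -/
lemma u_col (P : ℕ → UPlane) (m k : ℕ) (hmk : m ≤ k)
    (htri : ∃ p : UPlane, 0 < inner ℝ p (P (k + 1) - P k) ∧ 0 < inner ℝ p (P (k + 2) - P (k + 1)))
    (hdis : ∀ i, m ≤ i → i < k →
      Disjoint (segment ℝ (P i) (P (i + 1))) (segment ℝ (P (k + 1)) (P (k + 2)))) :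
    ∑ i ∈ Finset.Ico m k, uA (P (k + 1) - P i) (P (k + 1) - P (i + 1))
      + uA (P (k + 1) - P k) (P (k + 2) - P (k + 1))
    = uA (P (k + 1) - P m) (P (k + 2) - P m)
      + ∑ i ∈ Finset.Ico m (k + 1), uA (P (k + 2) - P i) (P (k + 2) - P (i + 1)) := by
  have key : ∀ l, m ≤ l → l ≤ k →
      ∑ i ∈ Finset.Ico m l, uA (P (k + 1) - P i) (P (k + 1) - P (i + 1))
        + uA (P (k + 1) - P l) (P (k + 2) - P l)
      = uA (P (k + 1) - P m) (P (k + 2) - P m)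
        + ∑ i ∈ Finset.Ico m l, uA (P (k + 2) - P i) (P (k + 2) - P (i + 1)) := by
    intro l hl
    induction l, hl using Nat.le_induction with
    | base => simp
    | succ l hl ih =>
      intro hlk
      have h1 := ih (by omega)
      have h2 := uA_cell (hdis l hl (by omega))
      rw [Finset.sum_Ico_succ_top hl, Finset.sum_Ico_succ_top hl]
      linarith
  have h1 := key k hmk le_rfl
  have h2 := uA_tri htri
  rw [Finset.sum_Ico_succ_top hmk]
  linarith

lemma u_main (N : ℕ) (P : ℕ → UPlane)
    (hper : P (N + 3) = P 0) (hper1 : P (N + 4) = P 1)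
    (hne : ∀ k, P (k + 1) ≠ P k)
    (htri : ∀ k, ∃ p : UPlane,
      0 < inner ℝ p (P (k + 1) - P k) ∧ 0 < inner ℝ p (P (k + 2) - P (k + 1)))
    (hdis : ∀ i k, i < k → k + 1 < N + 3 → (i ≠ 0 ∨ k + 1 ≠ N + 2) →
      Disjoint (segment ℝ (P i) (P (i + 1))) (segment ℝ (P (k + 1)) (P (k + 2))))
    (hext : ∃ p : UPlane, ∀ j, 1 ≤ j → j ≤ N + 2 → 0 < inner ℝ p (P j - P 0)) :
    (∑ k ∈ Finset.range (N + 3), uA (P (k + 1) - P k) (P (k + 2) - P (k + 1)))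
        = 2 * Real.pi ∨
    (∑ k ∈ Finset.range (N + 3), uA (P (k + 1) - P k) (P (k + 2) - P (k + 1)))
        = -(2 * Real.pi) := by
  have hF : ∀ k, k ≤ N + 1 →
      ∑ j ∈ Finset.range k, uA (P (j + 1) - P j) (P (j + 2) - P (j + 1))
      = ∑ j ∈ Finset.Ico 1 (k + 1), uA (P j - P 0) (P (j + 1) - P 0)
        + ∑ i ∈ Finset.Ico 0 k, uA (P (k + 1) - P i) (P (k + 1) - P (i + 1)) := by
    intro k
    induction k with
    | zero => intro _; simp
    | succ k ih =>
      intro hk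
      have h1 := ih (by omega)
      have h2 := u_col P 0 k (by omega) (htri k)
        (fun i _ hi => hdis i k hi (by omega) (by omega))
      rw [Finset.sum_range_succ, Finset.sum_Ico_succ_top (by omega)]
      have e : k + 1 + 1 = k + 2 := rfl
      rw [e]
      linarith
  obtain ⟨p, hp⟩ := hext
  have h1 := hF (N + 1) le_rfl
  have h2 := u_col P 1 (N + 1) (by omega) (htri (N + 1))
    (fun i h1 hi => hdis i (N + 1) hi (by omega) (by omega))
  have h3 := uA_tele (p := p) (fun j => P j - P 0) 1 (N + 2) (by omega) hp
  have h4 := uA_tele (p := p) (fun j => P j - P 0) 1 (N + 2) (by omega) hp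
  have h5 : ∑ i ∈ Finset.Ico 1 (N + 2), uA (P (N + 3) - P i) (P (N + 3) - P (i + 1))
      = uA (P 1 - P 0) (P (N + 2) - P 0) := by
    rw [← h3]
    refine Finset.sum_congr rfl fun i _ => ?_
    rw [hper, ← neg_sub (P i), ← neg_sub (P (i + 1)), uA_neg_neg]
  have h6 := uA_tri (htri (N + 2))
  have h6' : uA (P (N + 2) - P 0) (P (N + 2) - P 1) + uA (P (N + 2) - P 1) (P (N + 3) - P 1)
      = uA (P (N + 3) - P (N + 2)) (P (N + 4) - P (N + 3)) := by
    obtain ⟨q, hq1, hq2⟩ := htri (N + 2)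
    have e1 : P (N + 2 + 1) = P 0 := hper
    have e2 : P (N + 2 + 2) = P 1 := hper1
    rw [e1] at hq1
    rw [e1, e2] at hq2
    rw [hper, hper1, ← uA_neg_neg (P 0 - P (N + 2)), neg_sub, neg_sub]
    refine uA_add (p := -q) ?_ ?_ ?_
    · rw [inner_neg_left, ← inner_neg_right, neg_sub]; exact hq1
    · rw [inner_neg_left, ← inner_neg_right, neg_sub]
      have : P 1 - P (N + 2) = (P 0 - P (N + 2)) + (P 1 - P 0) := by abel
      rw [this, inner_add_right]; linarith
    · rw [inner_neg_left, ← inner_neg_right, neg_sub]; exact hq2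
  have h7 := uA_pi (a := P (N + 3) - P (N + 2)) (b := P (N + 4) - P (N + 3))
    (sub_ne_zero.mpr (hne _)) (sub_ne_zero.mpr (hne _))
  have h8 : uA (P (N + 4) - P (N + 3)) (-(P (N + 3) - P (N + 2)))
      = uA (P 1 - P 0) (P (N + 2) - P 0) := by
    rw [hper, hper1, neg_sub]
  rw [h8] at h7
  rw [Finset.sum_range_succ, Finset.sum_range_succ, h1]
  rw [Finset.sum_eq_sum_Ico_succ_bot (show 0 < N + 1 by omega)]
  simp only [zero_add, Nat.reduceAdd, add_assoc] at *
  rcases h7 with h7 | h7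
  · left; linarith
  · right; linarith

lemma u_sum_zmod (n : ℕ) [NeZero n] (f : ZMod n → ℝ) :
    ∑ i : ZMod n, f i = ∑ k ∈ Finset.range n, f (k : ZMod n) := by
  obtain _ | n := n
  · exact absurd rfl (NeZero.ne 0)
  · rw [← Fin.sum_univ_eq_sum_range (fun k => f (k : ZMod (n + 1)))]
    refine Finset.sum_congr rfl fun i _ => ?_
    congr 1
    exact (ZMod.natCast_zmod_val (n := n + 1) i).symm

/-- Discrete Umlaufsatz: the turning number of a simple closed polygon is `±1`,
i.e. its total signed curvature is `2π` or `-2π`. -/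
theorem discrete_umlaufsatz
    (n : ℕ) [NeZero n] (hn : 3 ≤ n)
    (C : ZMod n → EuclideanSpace ℝ (Fin 2))
    (hC : ∀ i : ZMod n, C (i + 1) ≠ C i)
    (hsimple : ∀ i j : ZMod n, i ≠ j →
      segment ℝ (C i) (C (i + 1)) ∩ segment ℝ (C j) (C (j + 1)) =
        if j = i + 1 then {C (i + 1)} else if j = i - 1 then {C i} else ∅) :
    (∑ i : ZMod n, (stdOrientation.oangle (C i - C (i - 1)) (C (i + 1) - C i)).toReal)
        = 2 * Real.pi ∨
    (∑ i : ZMod n, (stdOrientation.oangle (C i - C (i - 1)) (C (i + 1) - C i)).toReal)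
        = -(2 * Real.pi) := by
  have hinj : Function.Injective C := by
    intro i j hij
    by_contra hne
    have h := hsimple i j hne
    have hm : C i ∈ segment ℝ (C i) (C (i + 1)) ∩ segment ℝ (C j) (C (j + 1)) :=
      ⟨left_mem_segment ℝ _ _, hij ▸ left_mem_segment ℝ _ _⟩
    rw [h] at hm
    split_ifs at hm with h1 h2
    · exact hC i (h1 ▸ hij.symm)
    · apply hC j
      rw [← hij]; congr 1; rw [h2]; ring
    · exact hm
  obtain ⟨i0, hi0⟩ := Finite.exists_max (fun i => ‖C i‖)
  obtain ⟨N, rfl⟩ : ∃ N, n = N + 3 := ⟨n - 3, by omega⟩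
  have hcast : ∀ a b : ℕ, a < N + 3 → b < N + 3 → (a : ZMod (N + 3)) = b → a = b := by
    intro a b ha hb h
    have := (ZMod.natCast_eq_natCast_iff' a b (N + 3)).mp h
    rwa [Nat.mod_eq_of_lt ha, Nat.mod_eq_of_lt hb] at this
  have hself : ((N + 3 : ℕ) : ZMod (N + 3)) = 0 := ZMod.natCast_self _
  let P : ℕ → UPlane := fun k => C ((k : ZMod (N + 3)) + i0)
  have hP : ∀ k, P k = C ((k : ZMod (N + 3)) + i0) := fun _ => rfl
  have hP1 : ∀ k, P (k + 1) = C ((k : ZMod (N + 3)) + i0 + 1) := by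
    intro k; rw [hP]; congr 1; push_cast; ring
  have hsum : (∑ i : ZMod (N + 3),
      (stdOrientation.oangle (C i - C (i - 1)) (C (i + 1) - C i)).toReal)
      = ∑ k ∈ Finset.range (N + 3), uA (P (k + 1) - P k) (P (k + 2) - P (k + 1)) := by
    rw [← Equiv.sum_comp (Equiv.addRight (i0 + 1)), u_sum_zmod]
    refine Finset.sum_congr rfl fun k _ => ?_
    have e1 : (k : ZMod (N + 3)) + (i0 + 1) = ((k + 1 : ℕ) : ZMod (N + 3)) + i0 := by
      push_cast; ring
    have e2 : (k : ZMod (N + 3)) + (i0 + 1) - 1 = (k : ZMod (N + 3)) + i0 := by ring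
    have e3 : (k : ZMod (N + 3)) + (i0 + 1) + 1 = ((k + 2 : ℕ) : ZMod (N + 3)) + i0 := by
      push_cast; ring
    simp only [uA, hP, Equiv.coe_addRight]
    rw [e2, e3, e1]
  rw [hsum]
  apply u_main N P
  · rw [hP, hP, hself, Nat.cast_zero]
  · rw [hP, hP]; congr 2
    have : ((N + 4 : ℕ) : ZMod (N + 3)) = ((N + 3 : ℕ) : ZMod (N + 3)) + 1 := by push_cast; ring
    rw [this, hself]; simp
  · intro k; rw [hP1, hP]; exact hC _
  · intro k
    apply u_tri
    · rw [hP1, hP]; exact hC _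
    · rw [hP1 (k + 1), hP]; exact hC _
    · rw [show k + 2 = (k + 1) + 1 from rfl, hP1 (k + 1), hP1 k, hP k]
      have e : (((k + 1 : ℕ) : ZMod (N + 3)) + i0) = (k : ZMod (N + 3)) + i0 + 1 := by
        push_cast; ring
      rw [e]
      have hne : (k : ZMod (N + 3)) + i0 ≠ (k : ZMod (N + 3)) + i0 + 1 := by
        intro h
        have h' : ((0 : ℕ) : ZMod (N + 3)) = ((1 : ℕ) : ZMod (N + 3)) := by
          push_cast; linear_combination h
        exact absurd (hcast _ _ (by omega) (by omega) h') (by omega)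
      have := hsimple _ _ hne
      rwa [if_pos rfl] at this
  · intro i k hik hk hor
    rw [Set.disjoint_iff_inter_eq_empty, show k + 2 = (k + 1) + 1 from rfl, hP1 (k + 1), hP1 i,
      hP, hP]
    rw [hsimple, if_neg, if_neg]
    · intro h
      have h' : ((k + 2 : ℕ) : ZMod (N + 3)) = ((i : ℕ) : ZMod (N + 3)) := by
        push_cast at h ⊢; linear_combination h
      rcases Nat.lt_or_ge (k + 2) (N + 3) with hlt | hge
      · have := hcast _ _ hlt (by omega) h'; omega
      · have hk2 : k + 2 = N + 3 := by omega
        rw [hk2, hself] at h'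
        have := hcast 0 i (by omega) (by omega) (by simpa using h')
        omega
    · intro h
      have h' : ((k + 1 : ℕ) : ZMod (N + 3)) = ((i + 1 : ℕ) : ZMod (N + 3)) := by
        push_cast at h ⊢; linear_combination h
      have := hcast _ _ (by omega) (by omega) h'; omega
    · intro h
      have h' : ((i : ℕ) : ZMod (N + 3)) = ((k + 1 : ℕ) : ZMod (N + 3)) := by
        push_cast at h ⊢; linear_combination h
      have := hcast _ _ (by omega) (by omega) h'; omega
  · refine ⟨-P 0, fun j hj1 hj2 => ?_⟩
    have hne : P j ≠ P 0 := by
      intro h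
      have h1 := hinj h
      have := hcast j 0 (by omega) (by omega) (by linear_combination h1)
      omega
    have hP0 : P 0 = C i0 := by rw [hP]; simp
    have hle : ‖P j‖ ≤ ‖P 0‖ := by rw [hP0]; exact hi0 _
    have hpos : 0 < ‖P j - P 0‖ := norm_pos_iff.mpr (sub_ne_zero.mpr hne)
    have e1 := norm_sub_sq_real (P j) (P 0)
    rw [inner_neg_left, inner_sub_right, real_inner_self_eq_norm_sq, real_inner_comm]
    have := norm_nonneg (P j)
    nlinarith
end

section
/- (Milnor: the polygonal total curvature of a smooth closed curve equals the integral of its curvature.) Let d ≥ 1, L > 0, and let γ : ℝ → EuclideanSpace ℝ (Fin d) be twice continuously differentiable, L-periodic, and parametrized by arc length (‖γ'(t)‖ = 1 for all t). Let S ⊆ ℝ be the set of all numbers of the form ∑_{i ∈ ZMod m} angle(γ(t_{i+1}) − γ(t_i), γ(t_{i+2}) − γ(t_{i+1})), taken over all m ≥ 3 and all cyclic sequences of parameters t_0 < t_1 < ⋯ < t_{m−1} < t_0 + L (indices read modulo m, with t_{i+m} := t_i + L) such that γ(t_{i+1}) ≠ γ(t_i) for all i. Then ∫_0^L ‖γ''(t)‖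 dt is the least upper bound of S. -/
open InnerProductGeometry Filter Topology

section Milnor

theorem mil_norm_sub_eq {V : Type*} [NormedAddCommGroup V] [InnerProductSpace ℝ V] {x y : V}
    (hx : ‖x‖ = 1) (hy : ‖y‖ = 1) : ‖x - y‖ = 2 * Real.sin (angle x y / 2) := by
  have h1 := norm_sub_sq_real x y
  have h2 := inner_eq_cos_angle_of_norm_eq_one hx hy
  have h3 : 0 ≤ Real.sin (angle x y / 2) :=
    Real.sin_nonneg_of_nonneg_of_le_pi (by linarith [angle_nonneg x y])
      (by linarith [angle_nonneg x y, angle_le_pi x y, Real.pi_pos])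
  have h4 : Real.cos (angle x y) = 1 - 2 * Real.sin (angle x y / 2) ^ 2 := by
    have := Real.cos_two_mul (angle x y / 2)
    have h5 := Real.sin_sq_add_cos_sq (angle x y / 2)
    rw [show 2 * (angle x y / 2) = angle x y by ring] at this
    linarith
  rw [hx, hy, h2, h4] at h1
  rw [← sq_eq_sq₀ (norm_nonneg _) (by positivity), h1]
  ring

theorem mil_norm_sub_le_angle {V : Type*} [NormedAddCommGroup V] [InnerProductSpace ℝ V] {x y : V}
    (hx : ‖x‖ = 1) (hy : ‖y‖ = 1) : ‖x - y‖ ≤ angle x y := by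
  rw [mil_norm_sub_eq hx hy]
  linarith [Real.sin_le (show 0 ≤ angle x y / 2 by linarith [angle_nonneg x y])]

theorem mil_angle_le {V : Type*} [NormedAddCommGroup V] [InnerProductSpace ℝ V] {x y : V}
    (hx : ‖x‖ = 1) (hy : ‖y‖ = 1) : angle x y ≤ ‖x - y‖ + ‖x - y‖ ^ 3 := by
  have h0 : 0 ≤ angle x y := angle_nonneg x y
  have h1 := Real.sin_ge_sub_cube (show 0 ≤ angle x y / 2 by linarith)
  have h2 := Real.mul_le_sin (show 0 ≤ angle x y / 2 by linarith)
    (by linarith [angle_le_pi x y])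
  have h3 := mil_norm_sub_eq hx hy
  have h4 : angle x y ≤ 2 * ‖x - y‖ := by
    have : (1:ℝ) / 2 ≤ 2 / Real.pi := by
      rw [div_le_div_iff₀ (by norm_num) Real.pi_pos]; linarith [Real.pi_le_four]
    nlinarith
  have h5 : angle x y ^ 3 ≤ (2 * ‖x - y‖) ^ 3 := by gcongr
  nlinarith [pow_nonneg (norm_nonneg (x - y)) 3]

theorem mil_angle_chain {V : Type*} [NormedAddCommGroup V] [InnerProductSpace ℝ V] (n : ℕ)
    (p : ℕ → V) (B : V) :
    angle (p 0) B ≤ ∑ j ∈ Finset.range n, angle (p j) (p (j + 1)) + angle (p n) B := by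
  induction n with
  | zero => simp
  | succ n ih =>
    rw [Finset.sum_range_succ]
    linarith [angle_le_angle_add_angle (p n) (p (n + 1)) B]

theorem mil_cone {V : Type*} [NormedAddCommGroup V] [InnerProductSpace ℝ V] (B : V) (n : ℕ) :
    ∀ (p : ℕ → V) (A : V), (∀ j, p j ≠ 0) → (∑ j ∈ Finset.range (n + 1), p j) ≠ 0 →
    angle A (∑ j ∈ Finset.range (n + 1), p j) + angle (∑ j ∈ Finset.range (n + 1), p j) B ≤
      angle A (p 0) + (∑ j ∈ Finset.range n, angle (p j) (p (j + 1)) + angle (p n) B) := by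
  induction n with
  | zero => intro p A hp hs; simp
  | succ n ih =>
    intro p A hp hs
    rw [Finset.sum_range_succ'] at hs ⊢
    set w := ∑ j ∈ Finset.range (n + 1), p (j + 1) with hw
    by_cases h0 : w = 0
    · rw [h0, zero_add]
      linarith [mil_angle_chain (n + 1) p B]
    · have h1 := ih (fun j => p (j + 1)) (p 0) (fun j => hp _) h0
      simp only [← hw] at h1
      have h2 : angle (p 0) w = angle (p 0) (w + p 0) + angle (w + p 0) w := by
        apply angle_eq_angle_add_add_angle_add_of_mem_span hs
        rw [Submodule.mem_span_pair]
        exact ⟨1, 1, by simp [add_comm]⟩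
      rw [Finset.sum_range_succ']
      have h3 := angle_le_angle_add_angle A (p 0) (w + p 0)
      have h4 := angle_le_angle_add_angle (w + p 0) w B
      simp only [zero_add] at *
      linarith

theorem mil_taylor {V : Type*} [NormedAddCommGroup V] [InnerProductSpace ℝ V]
    {γ : ℝ → V} {C : ℝ} (hd : Differentiable ℝ γ)
    (hT : ∀ s t, ‖deriv γ t - deriv γ s‖ ≤ C * |t - s|) (s h : ℝ) (hh : 0 ≤ h) :
    ‖γ (s + h) - γ s - h • deriv γ s‖ ≤ C * h ^ 2 := by
  have hC : 0 ≤ C := by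
    have := (norm_nonneg _).trans (hT 0 1); simpa using this
  have := norm_image_sub_le_of_norm_deriv_le_segment' (a := s) (b := s + h)
    (f := fun x => γ x - (x - s) • deriv γ s) (f' := fun x => deriv γ x - (1:ℝ) • deriv γ s) (C := C * h)
    (fun x _ => by
      apply HasDerivAt.hasDerivWithinAt
      exact (hd x).hasDerivAt.sub (((hasDerivAt_id x).sub_const s).smul_const _))
    (fun x hx => by
      rw [one_smul]
      refine (hT s x).trans ?_
      rw [abs_of_nonneg (by linarith [hx.1])]
      exact mul_le_mul_of_nonneg_left (by linarith [hx.2]) hC) (s + h) ⟨by linarith, le_rfl⟩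
  simp only [add_sub_cancel_left, sub_self, zero_smul, sub_zero] at this
  rw [show γ (s + h) - γ s - h • deriv γ s = γ (s + h) - h • deriv γ s - γ s by abel]
  refine this.trans (le_of_eq (by ring))

theorem mil_norm_le_integral {V : Type*} [NormedAddCommGroup V] [InnerProductSpace ℝ V]
    [CompleteSpace V] {T : ℝ → V} (hT : ContDiff ℝ 1 T) {a b : ℝ} (hab : a ≤ b) :
    ‖T b - T a‖ ≤ ∫ t in a..b, ‖deriv T t‖ := by
  have hc : Continuous (deriv T) := hT.continuous_deriv le_rfl
  rw [← intervalIntegral.integral_deriv_eq_sub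
    (fun x _ => (hT.differentiable one_ne_zero) x) (hc.intervalIntegrable _ _)]
  exact intervalIntegral.norm_integral_le_integral_norm hab

theorem mil_tendsto_angle {V : Type*} [NormedAddCommGroup V] [InnerProductSpace ℝ V]
    {ι : Type*} {l : Filter ι} {f g : ι → V} {x y : V} (hf : Tendsto f l (𝓝 x))
    (hg : Tendsto g l (𝓝 y)) (hx : x ≠ 0) (hy : y ≠ 0) :
    Tendsto (fun i => angle (f i) (g i)) l (𝓝 (angle x y)) := by
  unfold InnerProductGeometry.angle
  refine (Real.continuous_arccos.tendsto _).comp ?_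
  exact (hf.inner hg).div (hf.norm.mul hg.norm)
    (mul_ne_zero (norm_ne_zero_iff.2 hx) (norm_ne_zero_iff.2 hy))

theorem mil_arc {V : Type*} [NormedAddCommGroup V] [InnerProductSpace ℝ V] [CompleteSpace V]
    {γ : ℝ → V} {C : ℝ} (hs : ContDiff ℝ 2 γ) (hu : ∀ t, ‖deriv γ t‖ = 1)
    (hT : ∀ s t, ‖deriv γ t - deriv γ s‖ ≤ C * |t - s|) {a b : ℝ} (hab : a < b)
    (hne : γ b ≠ γ a) :
    angle (deriv γ a) (γ b - γ a) + angle (γ b - γ a) (deriv γ b) ≤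
      ∫ t in a..b, ‖deriv (deriv γ) t‖ := by
  have hC : 0 ≤ C := by
    have := (norm_nonneg _).trans (hT 0 1); simpa using this
  have hd : Differentiable ℝ γ := hs.differentiable two_ne_zero
  have hT1 : ContDiff ℝ 1 (deriv γ) := by
    have : ContDiff ℝ (1 + 1) γ := by simpa [one_add_one_eq_two] using hs
    exact (contDiff_succ_iff_deriv.1 this).2.2
  have hc : Continuous (deriv (deriv γ)) := hT1.continuous_deriv le_rfl
  set h : ℕ → ℝ := fun n => (b - a) / ((n : ℝ) + 1) with hh
  have hpos : ∀ n, 0 < h n := fun n => div_pos (by linarith) (by positivity)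
  have hmul : ∀ n : ℕ, ((n : ℝ) + 1) * h n = b - a := fun n => by
    simp only [hh]; field_simp
  have hlim : Tendsto h atTop (𝓝 0) := by
    have := (tendsto_one_div_add_atTop_nhds_zero_nat (𝕜 := ℝ)).const_mul (b - a)
    simpa [hh, div_eq_mul_inv] using this
  set s : ℕ → ℕ → ℝ := fun n j => a + j * h n with hsdef
  have hs0 : ∀ n, s n 0 = a := fun n => by simp [hsdef]
  have hsn : ∀ n, s n (n + 1) = b := fun n => by
    simp only [hsdef]; push_cast; rw [hmul]; ring
  have hss : ∀ n j, s n (j + 1) = s n j + h n := fun n j => by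
    simp only [hsdef]; push_cast; ring
  set R : ℕ → V := fun n => h n • ∑ j ∈ Finset.range (n + 1 + 1), deriv γ (s n j) with hR
  have hRb : ∀ n, ‖R n - (γ b - γ a)‖ ≤ C * (b - a) * h n + h n := by
    intro n
    have e1 : γ b - γ a = ∑ j ∈ Finset.range (n + 1), (γ (s n (j + 1)) - γ (s n j)) := by
      rw [Finset.sum_range_sub (fun j => γ (s n j)), hsn, hs0]
    have e2 : R n - (γ b - γ a) = h n • deriv γ b -
        ∑ j ∈ Finset.range (n + 1), (γ (s n j + h n) - γ (s n j) - h n • deriv γ (s n j)) := by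
      rw [e1, Finset.sum_sub_distrib _ (fun j => h n • deriv γ (s n j))]
      simp only [hR, hss]
      rw [Finset.sum_range_succ, smul_add, ← Finset.smul_sum, hsn]
      abel
    rw [e2]
    refine (norm_sub_le _ _).trans ?_
    rw [norm_smul, hu, Real.norm_of_nonneg (hpos n).le, mul_one, add_comm]
    gcongr
    refine (norm_sum_le _ _).trans ?_
    refine (Finset.sum_le_card_nsmul _ _ (C * h n ^ 2)
      (fun j _ => mil_taylor hd hT _ _ (hpos n).le)).trans (le_of_eq ?_)
    simp only [Finset.card_range, nsmul_eq_mul]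
    push_cast
    rw [← hmul n]; ring
  have hRlim : Tendsto R atTop (𝓝 (γ b - γ a)) := by
    rw [tendsto_iff_norm_sub_tendsto_zero]
    refine squeeze_zero (fun n => norm_nonneg _) hRb ?_
    simpa using (hlim.const_mul (C * (b - a))).add hlim
  have hsum : ∀ n, ∑ j ∈ Finset.range (n + 1), angle (deriv γ (s n j)) (deriv γ (s n (j + 1))) ≤
      (∫ t in a..b, ‖deriv (deriv γ) t‖) + (b - a) * C ^ 3 * h n ^ 2 := by
    intro n
    have e1 : ∫ t in a..b, ‖deriv (deriv γ) t‖ =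
        ∑ j ∈ Finset.range (n + 1), ∫ t in (s n j)..(s n (j + 1)), ‖deriv (deriv γ) t‖ := by
      rw [intervalIntegral.sum_integral_adjacent_intervals
        (fun k _ => (hc.norm.intervalIntegrable _ _)), hs0, hsn]
    have e2 : (b - a) * C ^ 3 * h n ^ 2 = ∑ j ∈ Finset.range (n + 1), (C * h n) ^ 3 := by
      simp only [Finset.sum_const, Finset.card_range, nsmul_eq_mul]
      push_cast
      rw [← hmul n]; ring
    rw [e1, e2, ← Finset.sum_add_distrib]
    refine Finset.sum_le_sum fun j _ => ?_
    refine (mil_angle_le (hu _) (hu _)).trans ?_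
    rw [norm_sub_rev]
    refine add_le_add (mil_norm_le_integral hT1 (by rw [hss]; linarith [hpos n])) ?_
    have := hT (s n j) (s n (j + 1))
    rw [hss, add_sub_cancel_left, abs_of_pos (hpos n), ← hss] at this
    gcongr
  have hne' : γ b - γ a ≠ 0 := sub_ne_zero.2 hne
  have hun : ∀ t, deriv γ t ≠ 0 := fun t ht => by have := hu t; simp [ht] at this
  have hev : ∀ᶠ n in atTop, angle (deriv γ a) (R n) + angle (R n) (deriv γ b) ≤
      (∫ t in a..b, ‖deriv (deriv γ) t‖) + (b - a) * C ^ 3 * h n ^ 2 := by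
    filter_upwards [hRlim.eventually_ne hne'] with n hn
    have h0 : (∑ j ∈ Finset.range (n + 1 + 1), deriv γ (s n j)) ≠ 0 := by
      intro h0; apply hn; simp only [hR, h0, smul_zero]
    have := mil_cone (deriv γ b) (n + 1) (fun j => deriv γ (s n j)) (deriv γ a) (fun j => hun _) h0
    simp only [hR]
    rw [angle_smul_right_of_pos _ _ (hpos n), angle_smul_left_of_pos _ _ (hpos n)]
    simp only [hs0, hsn, angle_self (hun _)] at this
    linarith [hsum n]
  have hl1 : Tendsto (fun n => angle (deriv γ a) (R n) + angle (R n) (deriv γ b)) atTop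
      (𝓝 (angle (deriv γ a) (γ b - γ a) + angle (γ b - γ a) (deriv γ b))) := by
    refine Tendsto.add ?_ ?_
    · exact mil_tendsto_angle tendsto_const_nhds hRlim (hun _) hne'
    · exact mil_tendsto_angle hRlim tendsto_const_nhds hne' (hun _)
  have hl2 : Tendsto (fun n => (∫ t in a..b, ‖deriv (deriv γ) t‖) + (b - a) * C ^ 3 * h n ^ 2)
      atTop (𝓝 (∫ t in a..b, ‖deriv (deriv γ) t‖)) := by
    simpa using ((hlim.pow 2).const_mul ((b - a) * C ^ 3)).const_add
      (∫ t in a..b, ‖deriv (deriv γ) t‖)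
  exact le_of_tendsto_of_tendsto hl1 hl2 hev

theorem mil_contDiff_deriv {V : Type*} [NormedAddCommGroup V] [InnerProductSpace ℝ V]
    {γ : ℝ → V} (hs : ContDiff ℝ 2 γ) : ContDiff ℝ 1 (deriv γ) := by
  have : ContDiff ℝ (1 + 1) γ := by simpa [one_add_one_eq_two] using hs
  exact (contDiff_succ_iff_deriv.1 this).2.2

theorem mil_periodic_deriv {V : Type*} [NormedAddCommGroup V] [InnerProductSpace ℝ V]
    {f : ℝ → V} {L : ℝ} (hf : Function.Periodic f L) : Function.Periodic (deriv f) L := by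
  intro t
  rw [← deriv_comp_add_const]
  congr 1
  funext x
  exact hf x

theorem mil_lip {V : Type*} [NormedAddCommGroup V] [InnerProductSpace ℝ V]
    {γ : ℝ → V} {L : ℝ} (hL : 0 < L) (hs : ContDiff ℝ 2 γ) (hper : Function.Periodic γ L) :
    ∃ C : ℝ, ∀ s t, ‖deriv γ t - deriv γ s‖ ≤ C * |t - s| := by
  have hT1 := mil_contDiff_deriv hs
  have hc : Continuous (deriv (deriv γ)) := hT1.continuous_deriv le_rfl
  have hp := mil_periodic_deriv (mil_periodic_deriv hper)
  obtain ⟨C, hC⟩ := (hp.isBounded_of_continuous hL.ne' hc).exists_norm_le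
  refine ⟨C, fun s t => ?_⟩
  exact Convex.norm_image_sub_le_of_norm_deriv_le (𝕜 := ℝ) (s := Set.univ)
    (fun x _ => hT1.differentiable one_ne_zero x) (fun x _ => hC _ ⟨x, rfl⟩) convex_univ
    (Set.mem_univ _) (Set.mem_univ _)

theorem mil_upper {V : Type*} [NormedAddCommGroup V] [InnerProductSpace ℝ V] [CompleteSpace V]
    {γ : ℝ → V} {L : ℝ} (hL : 0 < L) (hs : ContDiff ℝ 2 γ) (hper : Function.Periodic γ L)
    (hu : ∀ t, ‖deriv γ t‖ = 1) (m : ℕ) (t : ℕ → ℝ) (htm : ∀ i, t (i + m) = t i + L)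
    (hlt : ∀ i, t i < t (i + 1)) (hne : ∀ i, γ (t (i + 1)) ≠ γ (t i)) :
    ∑ i ∈ Finset.range m, angle (γ (t (i + 1)) - γ (t i)) (γ (t (i + 2)) - γ (t (i + 1))) ≤
      ∫ t in (0 : ℝ)..L, ‖deriv (deriv γ) t‖ := by
  obtain ⟨C, hC⟩ := mil_lip hL hs hper
  have hc : Continuous (deriv (deriv γ)) := (mil_contDiff_deriv hs).continuous_deriv le_rfl
  have hp1 := mil_periodic_deriv hper
  have hp2 : Function.Periodic (fun t => ‖deriv (deriv γ) t‖) L := fun t => by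
    simp only [mil_periodic_deriv hp1 t]
  set α : ℕ → ℝ := fun i => angle (deriv γ (t i)) (γ (t (i + 1)) - γ (t i)) with hα
  set β : ℕ → ℝ := fun i => angle (γ (t (i + 1)) - γ (t i)) (deriv γ (t (i + 1))) with hβ
  have hm0 : t m = t 0 + L := by simpa using htm 0
  have hm1 : t (m + 1) = t 1 + L := by rw [← htm 1, add_comm]
  have hαm : α m = α 0 := by
    simp only [hα, hm0, hm1, hper _, hp1 _, zero_add]
  have hsα : ∑ i ∈ Finset.range m, α (i + 1) = ∑ i ∈ Finset.range m, α i := by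
    have h1 := Finset.sum_range_succ α m
    have h2 := Finset.sum_range_succ' α m
    linarith
  calc _ ≤ ∑ i ∈ Finset.range m, (β i + α (i + 1)) :=
        Finset.sum_le_sum fun i _ => angle_le_angle_add_angle _ _ _
    _ = ∑ i ∈ Finset.range m, (α i + β i) := by
        rw [Finset.sum_add_distrib, Finset.sum_add_distrib, hsα, add_comm]
    _ ≤ ∑ i ∈ Finset.range m, ∫ t in (t i)..(t (i + 1)), ‖deriv (deriv γ) t‖ :=
        Finset.sum_le_sum fun i _ => mil_arc hs hu hC (hlt i) (hne i)
    _ = ∫ t in (t 0)..(t 0 + L), ‖deriv (deriv γ) t‖ := by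
        rw [intervalIntegral.sum_integral_adjacent_intervals
          (fun k _ => (hc.norm.intervalIntegrable _ _)), hm0]
    _ = ∫ t in (0 : ℝ)..L, ‖deriv (deriv γ) t‖ := by
        rw [hp2.intervalIntegral_add_eq (t 0) 0, zero_add]

theorem mil_ne {V : Type*} [NormedAddCommGroup V] [InnerProductSpace ℝ V]
    {γ : ℝ → V} {C : ℝ} (hd : Differentiable ℝ γ) (hu : ∀ t, ‖deriv γ t‖ = 1)
    (hT : ∀ s t, ‖deriv γ t - deriv γ s‖ ≤ C * |t - s|) (s x : ℝ) (hx : 0 < x)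
    (hCx : C * x < 1) : γ (s + x) ≠ γ s := by
  intro he
  have := mil_taylor hd hT s x hx.le
  rw [he, sub_self, zero_sub, norm_neg, norm_smul, hu, Real.norm_of_nonneg hx.le] at this
  nlinarith

theorem mil_pair_sum (f : ℕ → ℝ) (N : ℕ) : ∑ k ∈ Finset.range (2 * N), f k =
    ∑ j ∈ Finset.range N, (f (2 * j) + f (2 * j + 1)) := by
  induction N with
  | zero => simp
  | succ n ih =>
    rw [show 2 * (n + 1) = 2 * n + 1 + 1 by ring, Finset.sum_range_succ, Finset.sum_range_succ,
      Finset.sum_range_succ, ih]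
    ring

theorem mil_chord_tendsto {V : Type*} [NormedAddCommGroup V] [InnerProductSpace ℝ V]
    {γ : ℝ → V} (hd : Differentiable ℝ γ) (s : ℝ) :
    Tendsto (fun h : ℝ => h⁻¹ • (γ (s + h) - γ s)) (𝓝[>] 0) (𝓝 (deriv γ s)) := by
  have := hasDerivAt_iff_tendsto_slope_zero.1 (hd s).hasDerivAt
  exact this.mono_left (nhdsWithin_mono _ (fun x hx => ne_of_gt hx))

theorem mil_local {V : Type*} [NormedAddCommGroup V] [InnerProductSpace ℝ V]
    [CompleteSpace V] {T : ℝ → V} (hT : ContDiff ℝ 1 T) {a b ε : ℝ} (hab : a ≤ b)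
    (hε : ∀ x ∈ Set.Icc a b, ‖deriv T x - deriv T a‖ ≤ ε) :
    ∫ t in a..b, ‖deriv T t‖ ≤ ‖T b - T a‖ + 2 * ε * (b - a) := by
  have hc : Continuous (deriv T) := hT.continuous_deriv le_rfl
  have h1 : ∫ t in a..b, ‖deriv T t‖ ≤ ∫ t in a..b, (‖deriv T a‖ + ε) := by
    refine intervalIntegral.integral_mono_on hab (hc.norm.intervalIntegrable _ _)
      (by simp) fun x hx => ?_
    have := norm_sub_norm_le (deriv T x) (deriv T a)
    linarith [hε x hx]
  have h2 : ‖(T b - b • deriv T a) - (T a - a • deriv T a)‖ ≤ ε * (b - a) := by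
    refine norm_image_sub_le_of_norm_deriv_le_segment' (a := a) (b := b)
      (f := fun x => T x - x • deriv T a) (f' := fun x => deriv T x - (1:ℝ) • deriv T a)
      (fun x _ => ?_) (fun x hx => ?_) b ⟨hab, le_rfl⟩
    · apply HasDerivAt.hasDerivWithinAt
      exact (hT.differentiable one_ne_zero x).hasDerivAt.sub ((hasDerivAt_id x).smul_const _)
    · rw [one_smul]; exact hε x ⟨hx.1, hx.2.le⟩
  have h3 : (b - a) * ‖deriv T a‖ ≤ ‖T b - T a‖ + ε * (b - a) := by
    have e : (b - a) • deriv T a = (T b - T a) -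
        ((T b - b • deriv T a) - (T a - a • deriv T a)) := by
      rw [sub_smul]; abel
    have := norm_sub_le (T b - T a) ((T b - b • deriv T a) - (T a - a • deriv T a))
    rw [← e, norm_smul, Real.norm_of_nonneg (by linarith)] at this
    linarith
  rw [intervalIntegral.integral_const, smul_eq_mul] at h1
  linarith

theorem mil_lower {V : Type*} [NormedAddCommGroup V] [InnerProductSpace ℝ V] [CompleteSpace V]
    {γ : ℝ → V} {L : ℝ} (hL : 0 < L) (hs : ContDiff ℝ 2 γ) (hper : Function.Periodic γ L)
    (hu : ∀ t, ‖deriv γ t‖ = 1) (B : ℝ)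
    (hB : ∀ (m : ℕ) (t : ℕ → ℝ), 3 ≤ m → (∀ i, t (i + m) = t i + L) →
      (∀ i, t i < t (i + 1)) → (∀ i, γ (t (i + 1)) ≠ γ (t i)) →
      ∑ i ∈ Finset.range m,
        angle (γ (t (i + 1)) - γ (t i)) (γ (t (i + 2)) - γ (t (i + 1))) ≤ B) :
    ∫ t in (0 : ℝ)..L, ‖deriv (deriv γ) t‖ ≤ B := by
  obtain ⟨C, hC⟩ := mil_lip hL hs hper
  have hd : Differentiable ℝ γ := hs.differentiable two_ne_zero
  have hT1 := mil_contDiff_deriv hs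
  have hc : Continuous (deriv (deriv γ)) := hT1.continuous_deriv le_rfl
  have hC0 : 0 ≤ C := by
    have := (norm_nonneg _).trans (hC 0 1); simpa using this
  have hun : ∀ t, deriv γ t ≠ 0 := fun t ht => by have := hu t; simp [ht] at this
  refine le_of_forall_pos_le_add fun ε hε => ?_
  set e := ε / (2 * L) with he
  have hepos : 0 < e := by positivity
  have huc := isCompact_Icc.uniformContinuousOn_of_continuous (hc.continuousOn (s := Set.Icc 0 L))
  obtain ⟨δ, hδ, hδe⟩ := Metric.uniformContinuousOn_iff.1 huc e hepos
  obtain ⟨n, hn⟩ := exists_nat_gt (L / δ + C * L)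
  set N : ℕ := n + 2 with hN
  have hNpos : (0 : ℝ) < N := by positivity
  have hnN : (n : ℝ) < N := by simp [hN]
  set H := L / N with hH
  have hHpos : 0 < H := by positivity
  have hNH : N * H = L := by rw [hH]; field_simp
  have hLδ : 0 < L / δ := by positivity
  have hHδ : H < δ := by
    rw [hH, div_lt_iff₀ hNpos]
    have : L / δ < N := by nlinarith
    rw [div_lt_iff₀ hδ] at this; linarith
  have hCH : C * H < 1 := by
    rw [hH, ← mul_div_assoc, div_lt_one hNpos]; linarith
  set s : ℕ → ℝ := fun j => j * H with hsdef
  have hss : ∀ j, s (j + 1) = s j + H := fun j => by simp only [hsdef]; push_cast; ring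
  have key : ∀ h, 0 < h → h < H → ∑ j ∈ Finset.range N,
      angle (h⁻¹ • (γ (s j + h) - γ (s j))) (h⁻¹ • (γ (s (j + 1) + h) - γ (s (j + 1)))) ≤ B := by
    intro h h0 h1
    set t : ℕ → ℝ := fun k => s (k / 2) + (k % 2 : ℕ) * h with ht
    have te : ∀ q, t (2 * q) = s q := fun q => by simp [ht]
    have todd : ∀ q, t (2 * q + 1) = s q + h := fun q => by
      simp only [ht]
      rw [show (2 * q + 1) / 2 = q by omega, show (2 * q + 1) % 2 = 1 by omega]; simp
    have te2 : ∀ q, t (2 * q + 2) = s q + H := fun q => by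
      rw [show 2 * q + 2 = 2 * (q + 1) by ring, te, hss]
    have todd2 : ∀ q, t (2 * q + 1 + 2) = s (q + 1) + h := fun q => by
      rw [show 2 * q + 1 + 2 = 2 * (q + 1) + 1 by ring, todd]
    have step : ∀ k, ∃ x, 0 < x ∧ x < H ∧ t (k + 1) = t k + x := by
      intro k
      obtain ⟨q, rfl | rfl⟩ := Nat.even_or_odd' k
      · exact ⟨h, h0, h1, by rw [todd, te]⟩
      · exact ⟨H - h, by linarith, by linarith, by rw [te2, todd]; ring⟩
    have hb := hB (2 * N) t (by omega) (fun i => by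
        simp only [ht]
        rw [show (i + 2 * N) / 2 = i / 2 + N by omega, show (i + 2 * N) % 2 = i % 2 by omega]
        simp only [hsdef]; push_cast; rw [← hNH]; push_cast; ring)
      (fun i => by obtain ⟨x, hx, -, h⟩ := step i; linarith)
      (fun i => by
        obtain ⟨x, hx, hx', h⟩ := step i
        rw [h]
        exact mil_ne hd hu hC _ _ hx (by nlinarith))
    rw [mil_pair_sum] at hb
    refine le_trans (Finset.sum_le_sum fun j _ => ?_) hb
    have h0' : 0 < h⁻¹ := inv_pos.2 h0
    rw [angle_smul_right_of_pos _ _ h0', angle_smul_left_of_pos _ _ h0']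
    have tt := angle_le_angle_add_angle (γ (s j + h) - γ (s j)) (γ (s (j + 1)) - γ (s j + h))
      (γ (s (j + 1) + h) - γ (s (j + 1)))
    rw [show 2 * j + 1 + 1 = 2 * j + 2 by ring, todd, te, te2, todd2, ← hss]
    exact tt
  have hlim : Tendsto (fun h : ℝ => ∑ j ∈ Finset.range N,
      angle (h⁻¹ • (γ (s j + h) - γ (s j))) (h⁻¹ • (γ (s (j + 1) + h) - γ (s (j + 1)))))
      (𝓝[>] 0) (𝓝 (∑ j ∈ Finset.range N, angle (deriv γ (s j)) (deriv γ (s (j + 1))))) :=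
    tendsto_finsetSum _ fun j _ => mil_tendsto_angle (mil_chord_tendsto hd _)
      (mil_chord_tendsto hd _) (hun _) (hun _)
  have hle : ∑ j ∈ Finset.range N, angle (deriv γ (s j)) (deriv γ (s (j + 1))) ≤ B := by
    refine le_of_tendsto hlim ?_
    filter_upwards [Ioo_mem_nhdsGT hHpos] with h hh
    exact key h hh.1 hh.2
  have e1 : ∫ t in (0:ℝ)..L, ‖deriv (deriv γ) t‖ =
      ∑ j ∈ Finset.range N, ∫ t in (s j)..(s (j + 1)), ‖deriv (deriv γ) t‖ := by
    rw [intervalIntegral.sum_integral_adjacent_intervals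
      (fun k _ => (hc.norm.intervalIntegrable _ _))]
    simp only [hsdef, Nat.cast_zero, zero_mul, hNH]
  have e2 : ε = ∑ j ∈ Finset.range N, 2 * e * H := by
    simp only [Finset.sum_const, Finset.card_range, nsmul_eq_mul]
    rw [show (N : ℝ) * (2 * e * H) = 2 * e * (N * H) by ring, hNH, he]
    field_simp
  calc ∫ t in (0:ℝ)..L, ‖deriv (deriv γ) t‖
      ≤ ∑ j ∈ Finset.range N, (angle (deriv γ (s j)) (deriv γ (s (j + 1))) + 2 * e * H) := by
        rw [e1]
        refine Finset.sum_le_sum fun j hj => ?_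
        have hjN : ((j : ℝ) + 1) ≤ N := by exact_mod_cast Finset.mem_range.1 hj
        have hsj : 0 ≤ s j := by simp only [hsdef]; positivity
        have hsj1 : s (j + 1) ≤ L := by
          simp only [hsdef]; push_cast; rw [← hNH]; gcongr
        have := mil_local hT1 (a := s j) (b := s (j + 1)) (ε := e) (by rw [hss]; linarith)
          (fun x hx => by
            rw [← dist_eq_norm]
            refine (hδe x ⟨by linarith [hx.1], by linarith [hx.2]⟩ (s j)
              ⟨hsj, by linarith [hx.1, hx.2]⟩ ?_).le
            have := hx.2
            rw [hss] at this
            rw [Real.dist_eq, abs_of_nonneg (by linarith [hx.1])]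
            linarith)
        rw [norm_sub_rev] at this
        have h3 := mil_norm_sub_le_angle (hu (s j)) (hu (s (j + 1)))
        rw [show s (j + 1) - s j = H by rw [hss]; ring] at this
        linarith
    _ ≤ B + ε := by
        rw [Finset.sum_add_distrib, ← e2]; linarith

end Milnor


/-- Milnor's theorem: for a closed unit-speed `C²` curve, the supremum of the total
curvatures of inscribed closed polygons is attained as the integral of the curvature:
`∫_0^L ‖γ''‖` is the least upper bound of the set of polygonal total curvatures. -/
theorem milnor_total_curvature
    (d : ℕ) (hd : 1 ≤ d) (L : ℝ) (hL : 0 < L)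
    (γ : ℝ → EuclideanSpace ℝ (Fin d))
    (hsmooth : ContDiff ℝ 2 γ)
    (hper : ∀ t : ℝ, γ (t + L) = γ t)
    (hunit : ∀ t : ℝ, ‖deriv γ t‖ = 1) :
    IsLUB
      {s : ℝ | ∃ m : ℕ, 3 ≤ m ∧ ∃ t : ℕ → ℝ,
        (∀ i : ℕ, t (i + m) = t i + L) ∧
        (∀ i : ℕ, t i < t (i + 1)) ∧
        (∀ i : ℕ, γ (t (i + 1)) ≠ γ (t i)) ∧
        s = ∑ i ∈ Finset.range m,
          InnerProductGeometry.angle (γ (t (i + 1)) - γ (t i)) (γ (t (i + 2)) - γ (t (i + 1)))}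
      (∫ t in (0 : ℝ)..L, ‖deriv (deriv γ) t‖) := by
  refine ⟨?_, ?_⟩
  · rintro s ⟨m, -, t, htm, hlt, hne, rfl⟩
    exact mil_upper hL hsmooth hper hunit m t htm hlt hne
  · intro B hB
    exact mil_lower hL hsmooth hper hunit B fun m t h3 htm hlt hne =>
      hB ⟨m, h3, t, htm, hlt, hne, rfl⟩
end

section
/- (Steiner–Minkowski formula.) Let n ≥ 1 and let N ⊆ EuclideanSpace ℝ (Fin n) be a nonempty compact convex set. Then there exist real coefficients c_0, c_1, …, c_n such that for every r ≥ 0, (volume (Metric.cthickening r N)).toReal = ∑_{k=0}^n c_k r^k; moreover c_0 = (volume N).toReal and c_n equals the Lebesgue volume of the unit ball of EuclideanSpace ℝ (Fin n). -/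
open MeasureTheory
open scoped Pointwise

namespace SM

/-- monotone additive functions on the nonnegative reals are linear -/
lemma additive_linear (h : ℝ → ℝ) (h0 : ∀ t, 0 ≤ t → 0 ≤ h t)
    (hadd : ∀ s t, 0 ≤ s → 0 ≤ t → h (s + t) = h s + h t) (t : ℝ) (ht : 0 ≤ t) :
    h t = t * h 1 := by
  have hz : h 0 = 0 := by have := hadd 0 0 le_rfl le_rfl; simp at this; exact this
  have hmono : ∀ s t, 0 ≤ s → s ≤ t → h s ≤ h t := by
    intro s t hs hst
    have := hadd s (t - s) hs (by linarith)
    have h2 := h0 (t - s) (by linarith)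
    rw [add_sub_cancel] at this
    linarith
  have hmul : ∀ (m : ℕ) (s : ℝ), 0 ≤ s → h (m * s) = m * h s := by
    intro m s hs
    induction m with
    | zero => simp [hz]
    | succ k ih =>
      have := hadd (k * s) s (by positivity) hs
      push_cast
      rw [add_mul, one_mul, this, ih]; ring
  have hb : ∀ m : ℕ, (m : ℝ) * |h t - t * h 1| ≤ h 1 := by
    intro m
    have h1 := hmul m t ht
    have hmt : (0 : ℝ) ≤ m * t := by positivity
    have f1 := Nat.floor_le hmt
    have f2 := Nat.lt_floor_add_one ((m : ℝ) * t)
    set k := ⌊(m : ℝ) * t⌋₊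
    have a1 := hmono _ _ (by positivity) f1
    have a2 := hmono _ _ hmt f2.le
    have a3 := hmul k 1 zero_le_one
    have a4 := hmul (k + 1) 1 zero_le_one
    have a5 := h0 1 zero_le_one
    push_cast at a4
    rw [mul_one] at a3 a4
    rw [a3] at a1
    rw [a4] at a2
    rw [h1] at a1 a2
    have : (m : ℝ) * |h t - t * h 1| = |m * h t - (m * t) * h 1| := by
      rw [show (m : ℝ) * h t - (m * t) * h 1 = m * (h t - t * h 1) by ring, abs_mul]
      simp
    rw [this, abs_le]
    constructor <;> nlinarith
  by_contra hne
  have hpos : 0 < |h t - t * h 1| := abs_pos.2 (sub_ne_zero.2 hne)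
  obtain ⟨m, hm⟩ := exists_nat_gt (h 1 / |h t - t * h 1|)
  rw [div_lt_iff₀ hpos] at hm
  linarith [hb m]

variable {n : ℕ}

local notation "E" n => EuclideanSpace ℝ (Fin n)

/-- `[0, t] u` -/
def seg (t : ℝ) (u : E n) : Set (E n) := (fun a : ℝ => a • u) '' Set.Icc 0 t

lemma seg_compact (t : ℝ) (u : E n) : IsCompact (seg t u) :=
  isCompact_Icc.image (by fun_prop)

lemma seg_convex (t : ℝ) (u : E n) : Convex ℝ (seg t u) :=
  (convex_Icc 0 t).is_linear_image (f := fun a : ℝ => a • u)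
    ⟨fun a b => add_smul a b u, fun a b => by simp [mul_smul]⟩

lemma seg_nonempty (t : ℝ) (ht : 0 ≤ t) (u : E n) : (seg t u).Nonempty :=
  ⟨0, 0, ⟨le_rfl, ht⟩, by simp⟩

lemma mem_add_seg {K : Set (E n)} {t : ℝ} {u x : E n} :
    x ∈ K + seg t u ↔ ∃ a ∈ Set.Icc 0 t, x - a • u ∈ K := by
  constructor
  · rintro ⟨k, hk, _, ⟨a, ha, rfl⟩, rfl⟩
    exact ⟨a, ha, by simpa using hk⟩
  · rintro ⟨a, ha, hx⟩
    exact ⟨_, hx, _, ⟨a, ha, rfl⟩, by simp⟩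

lemma seg_add_vol {K : Set (E n)} (hK : IsCompact K) (hc : Convex ℝ K) (u : E n) (s t : ℝ)
    (hs : 0 ≤ s) (ht : 0 ≤ t) :
    volume.real (K + seg (s + t) u) + volume.real K
      = volume.real (K + seg s u) + volume.real (K + seg t u) := by
  have e1 : K + seg (s + t) u = (K + seg s u) ∪ ((s • u) +ᵥ (K + seg t u)) := by
    ext x
    simp only [Set.mem_union, Set.mem_vadd_set_iff_neg_vadd_mem, mem_add_seg, vadd_eq_add]
    constructor
    · rintro ⟨a, ha, hx⟩
      rcases le_total a s with h | h
      · exact Or.inl ⟨a, ⟨ha.1, h⟩, hx⟩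
      · refine Or.inr ⟨a - s, ⟨by linarith, by linarith [ha.2]⟩, ?_⟩
        convert hx using 1
        module
    · rintro (⟨a, ha, hx⟩ | ⟨a, ha, hx⟩)
      · exact ⟨a, ⟨ha.1, by linarith [ha.2]⟩, hx⟩
      · refine ⟨a + s, ⟨by linarith [ha.1], by linarith [ha.2]⟩, ?_⟩
        convert hx using 1
        module
  have e2 : (K + seg s u) ∩ ((s • u) +ᵥ (K + seg t u)) = (s • u) +ᵥ K := by
    ext x
    simp only [Set.mem_inter_iff, Set.mem_vadd_set_iff_neg_vadd_mem, mem_add_seg, vadd_eq_add]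
    constructor
    · rintro ⟨⟨a, ha, hx⟩, ⟨b, hb, hy⟩⟩
      by_cases hab : (s - a) + b = 0
      · have : a = s := by linarith [ha.2, hb.1]
        subst this
        convert hx using 1
        module
      · have hpos : 0 < (s - a) + b := lt_of_le_of_ne (by linarith [ha.2, hb.1]) (Ne.symm hab)
        have := hc hx hy (a := b / ((s - a) + b)) (b := (s - a) / ((s - a) + b))
          (div_nonneg hb.1 hpos.le) (div_nonneg (by linarith [ha.2]) hpos.le)
          (by field_simp; ring)
        convert this using 1
        match_scalars
        · field_simp; ring
        · field_simp; ring
    · intro hx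
      refine ⟨⟨s, ⟨hs, le_rfl⟩, ?_⟩, ⟨0, ⟨le_rfl, ht⟩, ?_⟩⟩
      · convert hx using 1; module
      · convert hx using 1; module
  have hc1 : IsCompact (K + seg s u) := hK.add (seg_compact _ _)
  have hc2 : IsCompact ((s • u) +ᵥ (K + seg t u)) := (hK.add (seg_compact _ _)).vadd _
  have := measureReal_union_add_inter (μ := volume) (s := K + seg s u) hc2.measurableSet
    hc1.measure_lt_top.ne hc2.measure_lt_top.ne
  rw [← e1, e2] at this
  simpa [measureReal_def, measure_vadd] using this

lemma seg_affine {K : Set (E n)} (hK : IsCompact K) (hc : Convex ℝ K) (u : E n) (t : ℝ)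
    (ht : 0 ≤ t) :
    volume.real (K + seg t u)
      = volume.real K + t * (volume.real (K + seg 1 u) - volume.real K) := by
  have := additive_linear (fun t => volume.real (K + seg t u) - volume.real K) ?_ ?_ t ht
  · linarith
  · intro t ht
    have : volume.real K ≤ volume.real (K + seg t u) := by
      apply measureReal_mono
      · intro x hx
        exact mem_add_seg.2 ⟨0, ⟨le_rfl, ht⟩, by simpa using hx⟩
      · exact (hK.add (seg_compact t u)).measure_lt_top.ne
    simpa using this
  · intro s t hs ht
    have := seg_add_vol hK hc u s t hs ht
    linarith

/-- zonotopes -/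
def zono (r : ℝ) : List (E n) → Set (E n)
  | [] => {0}
  | u :: l => seg r u + zono r l

lemma zono_compact (r : ℝ) (l : List (E n)) : IsCompact (zono r l) := by
  induction l with
  | nil => exact isCompact_singleton
  | cons u l ih => exact (seg_compact _ _).add ih

lemma zono_convex (r : ℝ) (l : List (E n)) : Convex ℝ (zono r l) := by
  induction l with
  | nil => exact convex_singleton _
  | cons u l ih => exact (seg_convex _ _).add ih

lemma seg_smul (r : ℝ) (hr : 0 ≤ r) (u : E n) : seg r u = r • seg 1 u := by
  ext x
  simp only [seg, Set.mem_smul_set, Set.mem_image, Set.mem_Icc]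
  constructor
  · rintro ⟨a, ha, rfl⟩
    rcases hr.eq_or_lt with rfl | h
    · exact ⟨0, ⟨0, by simp, by simp⟩, by simp [le_antisymm ha.2 ha.1]⟩
    · refine ⟨_, ⟨a / r, ⟨div_nonneg ha.1 hr, (div_le_one h).2 ha.2⟩, rfl⟩, ?_⟩
      rw [smul_smul, mul_div_cancel₀ _ h.ne']
  · rintro ⟨_, ⟨a, ha, rfl⟩, rfl⟩
    exact ⟨r * a, ⟨by nlinarith, by nlinarith⟩, by rw [smul_smul]⟩

lemma zono_smul (r : ℝ) (hr : 0 ≤ r) (l : List (E n)) : zono r l = r • zono 1 l := by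
  induction l with
  | nil => simp [zono]
  | cons u l ih => simp only [zono]; rw [ih, seg_smul r hr, smul_add]

lemma zono_poly (l : List (E n)) : ∀ {K : Set (E n)}, IsCompact K → Convex ℝ K →
    ∃ p : Polynomial ℝ, ∀ r, 0 ≤ r → volume.real (K + zono r l) = p.eval r := by
  induction l with
  | nil => intro K _ _; exact ⟨Polynomial.C (volume.real K), by simp [zono]⟩
  | cons u l ih =>
    intro K hK hc
    obtain ⟨p, hp⟩ := ih hK hc
    obtain ⟨q, hq⟩ := ih (hK.add (seg_compact 1 u)) (hc.add (seg_convex 1 u))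
    refine ⟨p + Polynomial.X * (q - p), fun r hr => ?_⟩
    have h1 := seg_affine (hK.add (zono_compact r l)) (hc.add (zono_convex r l)) u r hr
    have e1 : K + zono r (u :: l) = K + zono r l + seg r u := by
      simp only [zono]; rw [add_assoc, add_comm (seg r u)]
    have e2 : K + zono r l + seg 1 u = K + seg 1 u + zono r l := by
      rw [add_right_comm]
    rw [e1, h1, e2, hp r hr, hq r hr]
    simp

/-- support function -/
noncomputable def supp (l : List (E n)) (v : E n) : ℝ := (l.map (fun u => max 0 (inner ℝ u v))).sum

lemma le_supp (l : List (E n)) (v : E n) : ∀ z ∈ zono 1 l, inner ℝ z v ≤ supp l v := by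
  induction l with
  | nil => simp [zono, supp]
  | cons u l ih =>
    rintro _ ⟨_, ⟨a, ha, rfl⟩, z, hz, rfl⟩
    have := ih z hz
    simp only [supp, List.map_cons, List.sum_cons] at this ⊢
    rw [inner_add_left, real_inner_smul_left]
    refine add_le_add ?_ this
    nlinarith [le_max_left 0 (inner ℝ u v), le_max_right 0 (inner ℝ u v), ha.1, ha.2]

lemma exists_supp (l : List (E n)) (v : E n) : ∃ z ∈ zono 1 l, inner ℝ z v = supp l v := by
  induction l with
  | nil => simp [zono, supp]
  | cons u l ih =>
    obtain ⟨z, hz, h⟩ := ih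
    rcases le_total (inner ℝ u v) 0 with h0 | h0
    · refine ⟨0 + z, ⟨0, ⟨0, by simp, by simp⟩, z, hz, rfl⟩, ?_⟩
      simp only [supp, List.map_cons, List.sum_cons] at h ⊢
      rw [max_eq_left h0, ← h]; simp
    · refine ⟨u + z, ⟨u, ⟨1, by simp, by simp⟩, z, hz, rfl⟩, ?_⟩
      simp only [supp, List.map_cons, List.sum_cons] at h ⊢
      rw [max_eq_right h0, ← h, inner_add_left]

lemma zono_sub (l : List (E n)) (a : ℝ) (h : ∀ v : E n, ‖v‖ = 1 → supp l v ≤ a) (ha : 0 ≤ a) :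
    zono 1 l ⊆ Metric.closedBall 0 a := by
  intro z hz
  rw [mem_closedBall_zero_iff]
  by_cases h0 : z = 0
  · simpa [h0] using ha
  have hz0 : 0 < ‖z‖ := norm_pos_iff.2 h0
  have h1 := h (‖z‖⁻¹ • z) (by rw [norm_smul]; simp [hz0.ne'])
  have h2 := le_supp l (‖z‖⁻¹ • z) z hz
  rw [real_inner_smul_right, real_inner_self_eq_norm_sq] at h2
  have : ‖z‖⁻¹ * ‖z‖ ^ 2 = ‖z‖ := by field_simp
  linarith

lemma sub_zono (l : List (E n)) (a : ℝ) (h : ∀ v : E n, ‖v‖ = 1 → a ≤ supp l v) :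
    Metric.closedBall 0 a ⊆ zono 1 l := by
  intro x hx
  rw [mem_closedBall_zero_iff] at hx
  by_contra hn
  obtain ⟨f, c, h1, h2⟩ := geometric_hahn_banach_closed_point (zono_convex 1 l)
    (zono_compact 1 l).isClosed hn
  set w := (InnerProductSpace.toDual ℝ (E n)).symm f with hw
  have hf : ∀ y, f y = inner ℝ y w := by
    intro y
    rw [real_inner_comm, hw, InnerProductSpace.toDual_symm_apply]
  have hlt : ∀ z ∈ zono 1 l, inner ℝ z w < inner ℝ x w := by
    intro z hz; rw [← hf, ← hf]; exact (h1 z hz).trans h2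
  have hw0 : w ≠ 0 := by
    intro h0
    obtain ⟨z, hz, -⟩ := exists_supp l 0
    have := hlt z hz
    simp [h0] at this
  have hp : 0 < ‖w‖ := norm_pos_iff.2 hw0
  obtain ⟨z, hz, hh⟩ := exists_supp l (‖w‖⁻¹ • w)
  have h3 := h (‖w‖⁻¹ • w) (by rw [norm_smul]; simp [hp.ne'])
  rw [← hh, real_inner_smul_right] at h3
  have h4 := hlt z hz
  have h5 := real_inner_le_norm x w
  have h6 : ‖w‖⁻¹ * inner ℝ z w < ‖w‖⁻¹ * (‖x‖ * ‖w‖) :=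
    mul_lt_mul_of_pos_left (by linarith) (inv_pos.2 hp)
  have : ‖w‖⁻¹ * (‖x‖ * ‖w‖) = ‖x‖ := by field_simp
  linarith


lemma integrable_max (f : (E n) → (E n)) (μ : Measure (E n)) (hf : Integrable f μ) (v : E n) :
    Integrable (fun u => max 0 (inner ℝ (f u) v)) μ := by
  have : Integrable (fun u => inner ℝ (f u) v) μ := hf.inner_const v
  simpa [max_comm] using this.pos_part

lemma exists_zono (hn : 1 ≤ n) (ε : ℝ) (hε : 0 < ε) :
    ∃ l : List (E n), ∀ v : E n, ‖v‖ = 1 → |supp l v - 1| ≤ ε := by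
  set B : Set (E n) := Metric.closedBall 0 1 with hB
  set μ : Measure (E n) := volume.restrict B with hμ
  have : IsFiniteMeasure μ := ⟨by
    rw [hμ, Measure.restrict_apply_univ]; exact (isCompact_closedBall _ _).measure_lt_top⟩
  have hid : Integrable (fun u : E n => u) μ :=
    (continuous_id.continuousOn.integrableOn_compact (isCompact_closedBall _ _))
  let I : (E n) → ℝ := fun v => ∫ u, max 0 (inner ℝ u v) ∂μ
  have hrot : ∀ v w : E n, ‖v‖ = 1 → ‖w‖ = 1 → I v = I w := by
    intro v w hv hw
    let T := Submodule.reflection (Submodule.span ℝ {v - w})ᗮ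
    have hT : T v = w := Submodule.reflection_sub (hv.trans hw.symm)
    have h1 := (T.measurePreserving).setIntegral_preimage_emb
      T.toHomeomorph.measurableEmbedding (fun u => max 0 (inner ℝ u w)) B
    have h2 : T ⁻¹' B = B := by ext x; simp [hB]
    rw [h2] at h1
    simp only [I, hμ]
    rw [← h1]
    congr 1
    ext u
    rw [← hT, T.inner_map_map]
  let v0 : E n := EuclideanSpace.single ⟨0, hn⟩ 1
  have hv0 : ‖v0‖ = 1 := by simp [v0]
  have hpos : 0 < I v0 := by
    simp only [I]
    rw [integral_pos_iff_support_of_nonneg (f := fun u : E n => max 0 (inner ℝ u v0))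
      (fun u => le_max_left _ _)
      (integrable_max (fun u => u) μ hid v0)]
    have hsub : Metric.ball ((1 / 2 : ℝ) • v0) (1 / 2) ⊆
        (Function.support fun u : E n => max 0 (inner ℝ u v0)) ∩ B := by
      intro u hu
      rw [mem_ball_iff_norm] at hu
      constructor
      · have h1 := (abs_le.1 (abs_real_inner_le_norm (u - (1 / 2 : ℝ) • v0) v0)).1
        rw [inner_sub_left, real_inner_smul_left, real_inner_self_eq_norm_sq, hv0] at h1
        have : 0 < inner ℝ u v0 := by linarith
        simp only [Function.mem_support]
        rw [max_eq_right this.le]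
        exact this.ne'
      · rw [hB, mem_closedBall_zero_iff]
        have h1 := norm_add_le (u - (1 / 2 : ℝ) • v0) ((1 / 2 : ℝ) • v0)
        rw [sub_add_cancel, norm_smul ((1 / 2 : ℝ)) v0, hv0] at h1
        norm_num at h1 hu
        linarith
    rw [hμ, Measure.restrict_apply' (Metric.isClosed_closedBall.measurableSet)]
    exact (Metric.measure_ball_pos volume _ (by norm_num)).trans_le (measure_mono hsub)
  set c := I v0 with hc
  have hmem : MemLp (fun u : E n => u) 1 μ := memLp_one_iff_integrable.2 hid
  obtain ⟨f, hf1, hf2⟩ := hmem.exists_simpleFunc_eLpNorm_sub_lt (by simp)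
    (ε := ENNReal.ofReal (c * ε)) (by simp; positivity)
  have hfi : Integrable f μ := memLp_one_iff_integrable.1 hf2
  have hf3 : ∫ u, ‖u - f u‖ ∂μ < c * ε := by
    rw [eLpNorm_one_eq_lintegral_enorm] at hf1
    have hh := integral_norm_eq_lintegral_enorm (hid.sub hfi).1
    simp only [Pi.sub_apply] at hh hf1
    rw [hh]
    exact ENNReal.toReal_lt_of_lt_ofReal hf1
  refine ⟨f.range.toList.map (fun y => (μ.real (f ⁻¹' {y}) / c) • y), fun v hv => ?_⟩
  have hs : supp (f.range.toList.map (fun y => (μ.real (f ⁻¹' {y}) / c) • y)) v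
      = (∫ u, max 0 (inner ℝ (f u) v) ∂μ) / c := by
    have h1 := SimpleFunc.map_integral (μ := μ) f (fun y => max 0 (inner ℝ y v)) hfi (by simp)
    rw [SimpleFunc.integral_eq_integral _ (by
      simpa [Function.comp_def] using integrable_max f μ hfi v)] at h1
    simp only [SimpleFunc.map_apply] at h1
    rw [h1, Finset.sum_div]
    simp only [supp, List.map_map]
    rw [Finset.sum_map_toList]
    refine Finset.sum_congr rfl fun y _ => ?_
    simp only [Function.comp, real_inner_smul_left, smul_eq_mul]
    have hnn : 0 ≤ μ.real (f ⁻¹' {y}) / c := div_nonneg measureReal_nonneg hpos.le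
    have := mul_max_of_nonneg 0 (inner ℝ y v) hnn
    rw [mul_zero] at this
    rw [← this]
    ring
  have h1 : I v = c := hrot v v0 hv hv0
  have h2 : |(∫ u, max 0 (inner ℝ (f u) v) ∂μ) - I v| ≤ c * ε := by
    simp only [I]
    rw [← integral_sub (integrable_max f μ hfi v) (integrable_max (fun u => u) μ hid v),
      ← Real.norm_eq_abs]
    refine (norm_integral_le_integral_norm _).trans (le_trans ?_ hf3.le)
    refine integral_mono ((integrable_max f μ hfi v).sub
      (integrable_max (fun u => u) μ hid v)).norm (hid.sub hfi).norm fun u => ?_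
    simp only [Real.norm_eq_abs]
    have a1 := abs_max_sub_max_le_abs (inner ℝ (f u) v) (inner ℝ u v) 0
    rw [max_comm _ (0 : ℝ), max_comm _ (0 : ℝ)] at a1
    refine a1.trans ?_
    rw [← inner_sub_left]
    refine (abs_real_inner_le_norm _ _).trans ?_
    rw [hv, mul_one, norm_sub_rev]
  rw [hs, show (∫ u, max 0 (inner ℝ (f u) v) ∂μ) / c - 1
    = ((∫ u, max 0 (inner ℝ (f u) v) ∂μ) - I v) / c by rw [h1]; field_simp,
    abs_div, abs_of_pos hpos, div_le_iff₀ hpos]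
  linarith

/-- degree bound from growth -/
lemma degree_bound (p : Polynomial ℝ) (n : ℕ) (R w : ℝ) (hR : 0 ≤ R) (hw : 0 < w)
    (h : ∀ r, 0 ≤ r → |p.eval r| ≤ (R + 2 * r) ^ n * w) : p.degree ≤ n := by
  by_contra hlt
  push Not at hlt
  let q : Polynomial ℝ := (Polynomial.C R + Polynomial.C 2 * Polynomial.X) ^ n * Polynomial.C w
  have hq : ∀ r, q.eval r = (R + 2 * r) ^ n * w := by intro r; simp [q]
  have hqd : q.degree ≤ n := by
    have : q.natDegree ≤ n := by
      simp only [q]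
      compute_degree
    exact Polynomial.degree_le_of_natDegree_le this
  have h1 := Polynomial.isLittleO_atTop_of_degree_lt q p (hqd.trans_lt hlt)
  have h2 : p.eval =O[Filter.atTop] q.eval := by
    refine Asymptotics.IsBigO.of_bound 1 ?_
    filter_upwards [Filter.eventually_ge_atTop 0] with r hr
    rw [one_mul, Real.norm_eq_abs, Real.norm_eq_abs, hq]
    exact (h r hr).trans (le_abs_self _)
  have h3 := h1.trans_isBigO h2
  have h4 := Asymptotics.isLittleO_irrefl (f'' := fun r => q.eval r) (l := Filter.atTop) ?_
  · exact h4 h3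
  · apply Filter.Eventually.frequently
    filter_upwards [Filter.eventually_gt_atTop 0] with r hr
    rw [hq]
    positivity

lemma vol_closedBall (r : ℝ) (hr : 0 ≤ r) :
    volume.real (Metric.closedBall (0 : E n) r) = r ^ n * volume.real (Metric.ball (0 : E n) 1) := by
  rw [measureReal_def, Measure.addHaar_closedBall _ _ hr, ENNReal.toReal_mul, measureReal_def,
    ENNReal.toReal_ofReal (by positivity)]
  simp

lemma vol_smul (r : ℝ) (hr : 0 ≤ r) (s : Set (E n)) :
    volume.real (r • s) = r ^ n * volume.real s := by
  rw [measureReal_def, Measure.addHaar_smul_of_nonneg _ hr, ENNReal.toReal_mul, measureReal_def,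
    ENNReal.toReal_ofReal (by positivity)]
  simp

/-- main part for bodies containing the origin -/
lemma main_zero (hn : 1 ≤ n) (K : Set (E n)) (hK : IsCompact K) (hc : Convex ℝ K)
    (h0 : (0 : E n) ∈ K) :
    ∃ p : Polynomial ℝ, p.natDegree < n + 1 ∧ ∀ r, 0 ≤ r →
      volume.real (K + Metric.closedBall 0 r) = p.eval r := by
  obtain ⟨R, hR0, hR⟩ : ∃ R, 0 ≤ R ∧ K ⊆ Metric.closedBall 0 R := by
    obtain ⟨R, hR⟩ := hK.isBounded.subset_closedBall 0
    exact ⟨max R 0, le_max_right _ _, hR.trans (Metric.closedBall_subset_closedBall (le_max_left _ _))⟩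
  set w := volume.real (Metric.ball (0 : E n) 1) with hw
  have hwpos : 0 < w := by
    rw [hw, measureReal_def]
    exact ENNReal.toReal_pos (Metric.measure_ball_pos volume _ one_pos).ne' measure_ball_lt_top.ne
  let e : ℕ → ℝ := fun j => 1 / ((j : ℝ) + 1)
  have he0 : ∀ j, 0 < e j := fun j => by simp only [e]; positivity
  have he1 : ∀ j, e j ≤ 1 := fun j => by
    simp only [e]; rw [div_le_one (by positivity)]; linarith [(Nat.cast_nonneg j : (0 : ℝ) ≤ j)]
  have helim : Filter.Tendsto e Filter.atTop (nhds 0) := tendsto_one_div_add_atTop_nhds_zero_nat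
  choose l hl using fun j => exists_zono hn (e j) (he0 j)
  have hup : ∀ j, zono 1 (l j) ⊆ Metric.closedBall 0 (1 + e j) := fun j =>
    zono_sub _ _ (fun v hv => by linarith [(abs_le.1 (hl j v hv)).2]) (by linarith [he0 j])
  have hlo : ∀ j, Metric.closedBall 0 (1 - e j) ⊆ zono 1 (l j) := fun j =>
    sub_zono _ _ (fun v hv => by linarith [(abs_le.1 (hl j v hv)).1])
  choose p hp using fun j => zono_poly (l j) hK hc
  let V : ℝ → ℝ := fun r => volume.real (K + Metric.closedBall 0 r)
  have hball : ∀ a r : ℝ, 0 ≤ a → 0 ≤ r →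
      a • Metric.closedBall (0 : E n) r = Metric.closedBall 0 (a * r) := by
    intro a r ha hr
    rw [smul_closedBall _ _ hr, smul_zero, Real.norm_of_nonneg ha]
  have hcomp : ∀ j r, IsCompact (K + zono r (l j)) := fun j r => hK.add (zono_compact _ _)
  have hzup : ∀ j r, 0 ≤ r → K + zono r (l j) ⊆ (1 + e j) • (K + Metric.closedBall 0 r) := by
    intro j r hr
    rw [zono_smul r hr, smul_add, hball _ _ (by linarith [he0 j]) hr]
    refine Set.add_subset_add ?_ ?_
    · intro x hx
      have hp1 : 0 < 1 + e j := by linarith [he0 j]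
      refine (Set.mem_smul_set_iff_inv_smul_mem₀ hp1.ne' _ _).2 ?_
      exact hc.smul_mem_of_zero_mem h0 hx
        ⟨(inv_pos.2 hp1).le, inv_le_one_of_one_le₀ (by linarith [he0 j])⟩
    · rw [mul_comm, ← hball _ _ hr (by linarith [he0 j])]
      exact Set.smul_set_mono (hup j)
  have hzlo : ∀ j r, 0 ≤ r → (1 - e j) • (K + Metric.closedBall 0 r) ⊆ K + zono r (l j) := by
    intro j r hr
    rw [zono_smul r hr, smul_add, hball _ _ (by linarith [he1 j]) hr]
    refine Set.add_subset_add ?_ ?_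
    · rintro _ ⟨x, hx, rfl⟩
      exact hc.smul_mem_of_zero_mem h0 hx ⟨by linarith [he1 j], by linarith [he0 j]⟩
    · rw [mul_comm, ← hball _ _ hr (by linarith [he1 j])]
      exact Set.smul_set_mono (hlo j)
  have hVc : ∀ r, IsCompact (K + Metric.closedBall 0 r) :=
    fun r => hK.add (isCompact_closedBall _ _)
  have hbu : ∀ j r, 0 ≤ r → (p j).eval r ≤ (1 + e j) ^ n * V r := by
    intro j r hr
    rw [← hp j r hr, ← vol_smul _ (by linarith [he0 j])]
    exact measureReal_mono (hzup j r hr) ((hVc r).smul _).measure_lt_top.ne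
  have hbl : ∀ j r, 0 ≤ r → (1 - e j) ^ n * V r ≤ (p j).eval r := by
    intro j r hr
    rw [← hp j r hr, ← vol_smul _ (by linarith [he1 j])]
    exact measureReal_mono (hzlo j r hr) (hcomp j r).measure_lt_top.ne
  have hlim : ∀ r, 0 ≤ r → Filter.Tendsto (fun j => (p j).eval r) Filter.atTop (nhds (V r)) := by
    intro r hr
    refine tendsto_of_tendsto_of_tendsto_of_le_of_le ?_ ?_ (fun j => hbl j r hr)
      (fun j => hbu j r hr)
    · have := ((helim.const_sub 1).pow n).mul_const (V r)
      simpa using this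
    · have := ((helim.const_add 1).pow n).mul_const (V r)
      simpa using this
  have hdeg : ∀ j, (p j).degree ≤ n := by
    intro j
    refine degree_bound (p j) n R w hR0 hwpos fun r hr => ?_
    rw [← hp j r hr, abs_of_nonneg measureReal_nonneg, ← vol_closedBall _ (by positivity)]
    refine measureReal_mono ?_ (isCompact_closedBall _ _).measure_lt_top.ne
    rintro _ ⟨x, hx, y, hy, rfl⟩
    rw [zono_smul r hr] at hy
    obtain ⟨z, hz, rfl⟩ := hy
    have h1 := hR hx
    have h2 := hup j hz
    rw [mem_closedBall_zero_iff] at *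
    refine (norm_add_le _ _).trans (add_le_add h1 ?_)
    simp only [norm_smul, Real.norm_of_nonneg hr]
    nlinarith [he1 j]
  let s := Finset.range (n + 1)
  let v : ℕ → ℝ := fun i => i
  have hvs : Set.InjOn v s := Nat.cast_injective.injOn
  have hpe : ∀ j r, (p j).eval r = ∑ i ∈ s, (p j).eval (v i) * (Lagrange.basis s v i).eval r := by
    intro j r
    conv_lhs => rw [Lagrange.eq_interpolate hvs (f := p j) (by
      simp only [s, Finset.card_range]
      exact (hdeg j).trans_lt (by exact_mod_cast Nat.lt_succ_self n))]
    simp [Lagrange.interpolate_apply, Polynomial.eval_finsetSum]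
  refine ⟨Lagrange.interpolate s v (fun i => V (v i)), ?_, fun r hr => ?_⟩
  · have := Lagrange.degree_interpolate_lt (fun i => V (v i)) hvs
    simp only [s, Finset.card_range] at this
    by_cases hz : Lagrange.interpolate s v (fun i => V (v i)) = 0
    · rw [hz]; simp
    · exact (Polynomial.natDegree_lt_iff_degree_lt hz).2 this
  · have h1 := hlim r hr
    have h2 : Filter.Tendsto (fun j => (p j).eval r) Filter.atTop
        (nhds (∑ i ∈ s, V (v i) * (Lagrange.basis s v i).eval r)) := by
      simp_rw [hpe _ r]
      exact tendsto_finsetSum _ fun i _ => (hlim (v i) (Nat.cast_nonneg i)).mul_const _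
    have h3 := tendsto_nhds_unique h1 h2
    simp only [V] at h3
    rw [h3]
    simp [Lagrange.interpolate_apply, Polynomial.eval_finsetSum, V]

end SM

theorem steiner_minkowski
    (n : ℕ) (hn : 1 ≤ n)
    (N : Set (EuclideanSpace ℝ (Fin n)))
    (hne : N.Nonempty) (hcomp : IsCompact N) (hconv : Convex ℝ N) :
    ∃ c : Fin (n + 1) → ℝ,
      (∀ r : ℝ, 0 ≤ r →
        (volume (Metric.cthickening r N)).toReal = ∑ k : Fin (n + 1), c k * r ^ (k : ℕ)) ∧
      c 0 = (volume N).toReal ∧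
      c ⟨n, Nat.lt_succ_self n⟩
        = (volume (Metric.ball (0 : EuclideanSpace ℝ (Fin n)) 1)).toReal := by
  obtain ⟨x0, hx0⟩ := hne
  obtain ⟨p, hpd, hp⟩ := SM.main_zero hn (-x0 +ᵥ N) (hcomp.vadd _) (hconv.vadd _)
    (by rw [Set.mem_vadd_set_iff_neg_vadd_mem]; simpa using hx0)
  have hV : ∀ r : ℝ, 0 ≤ r → (volume (Metric.cthickening r N)).toReal = p.eval r := by
    intro r hr
    rw [← hp r hr, vadd_add_assoc, measureReal_def, measure_vadd, hcomp.add_closedBall_zero hr]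
  have hsum : ∀ r : ℝ, p.eval r = ∑ k : Fin (n + 1), p.coeff k * r ^ (k : ℕ) := by
    intro r
    rw [Polynomial.eval_eq_sum_range' hpd, Finset.sum_range]
  refine ⟨fun k => p.coeff k, fun r hr => by rw [hV r hr, hsum], ?_, ?_⟩
  · have := hV 0 le_rfl
    rw [Metric.cthickening_zero, hcomp.isClosed.closure_eq] at this
    rw [this]
    simp [Polynomial.coeff_zero_eq_eval_zero]
  · obtain ⟨R, hR0, hR⟩ : ∃ R, 0 ≤ R ∧ N ⊆ Metric.closedBall 0 R := by
      obtain ⟨R, hR⟩ := hcomp.isBounded.subset_closedBall 0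
      exact ⟨max R 0, le_max_right _ _,
        hR.trans (Metric.closedBall_subset_closedBall (le_max_left _ _))⟩
    set w := (volume (Metric.ball (0 : EuclideanSpace ℝ (Fin n)) 1)).toReal with hw
    let g : ℝ → ℝ := fun s => ∑ k : Fin (n + 1), p.coeff k * s ^ (n - (k : ℕ))
    have hg : ∀ s : ℝ, 0 < s → g s = s ^ n * p.eval s⁻¹ := by
      intro s hs
      rw [hsum, Finset.mul_sum]
      refine Finset.sum_congr rfl fun k _ => ?_
      rw [pow_sub₀ s hs.ne' (Nat.lt_succ_iff.1 k.2), inv_pow]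
      ring
    have hg0 : g 0 = p.coeff n := by
      simp only [g]
      rw [Finset.sum_eq_single (⟨n, Nat.lt_succ_self n⟩ : Fin (n + 1))]
      · simp
      · intro b _ hb
        have : n - (b : ℕ) ≠ 0 := by
          intro h
          apply hb
          ext
          have := b.2
          simp only
          omega
        simp [this]
      · simp
    have hgc : Filter.Tendsto g (nhdsWithin 0 (Set.Ioi 0)) (nhds (p.coeff n)) := by
      rw [← hg0]
      have : Continuous g := by fun_prop
      exact this.continuousAt.tendsto.mono_left nhdsWithin_le_nhds
    have hlow : ∀ s : ℝ, 0 < s → w ≤ g s := by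
      intro s hs
      have h1 : (s⁻¹) ^ n * w ≤ p.eval s⁻¹ := by
        rw [← hV _ (inv_pos.2 hs).le, hw, ← measureReal_def,
          ← SM.vol_closedBall _ (inv_pos.2 hs).le, ← measureReal_def]
        have : volume.real (Metric.closedBall (0 : EuclideanSpace ℝ (Fin n)) s⁻¹)
            = volume.real (Metric.closedBall x0 s⁻¹) := by
          simp only [measureReal_def]; rw [Measure.addHaar_closedBall_center volume x0]
        rw [this]
        refine measureReal_mono (Metric.closedBall_subset_cthickening hx0 _)
          hcomp.cthickening.measure_lt_top.ne
      rw [hg s hs]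
      calc w = s ^ n * ((s⁻¹) ^ n * w) := by rw [← mul_assoc, ← mul_pow, mul_inv_cancel₀ hs.ne']; simp
        _ ≤ _ := by gcongr
    have hupp : ∀ s : ℝ, 0 < s → g s ≤ (R * s + 1) ^ n * w := by
      intro s hs
      have hi := (inv_pos.2 hs).le
      have h1 : p.eval s⁻¹ ≤ (R + s⁻¹) ^ n * w := by
        have hb := SM.vol_closedBall (n := n) (R + s⁻¹) (by positivity)
        rw [measureReal_def, measureReal_def, ← hw] at hb
        rw [← hV _ hi, ← hb, ← measureReal_def, ← measureReal_def]
        refine measureReal_mono ?_ (isCompact_closedBall _ _).measure_lt_top.ne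
        rw [← hcomp.add_closedBall_zero hi]
        rintro _ ⟨x, hx, y, hy, rfl⟩
        have h1 := hR hx
        rw [mem_closedBall_zero_iff] at *
        exact (norm_add_le _ _).trans (add_le_add h1 hy)
      rw [hg s hs]
      calc s ^ n * p.eval s⁻¹ ≤ s ^ n * ((R + s⁻¹) ^ n * w) := by gcongr
        _ = (R * s + 1) ^ n * w := by
          rw [← mul_assoc, ← mul_pow]; congr 2; field_simp
    have hul : Filter.Tendsto (fun s : ℝ => (R * s + 1) ^ n * w) (nhdsWithin 0 (Set.Ioi 0))
        (nhds w) := by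
      have : Continuous (fun s : ℝ => (R * s + 1) ^ n * w) := by fun_prop
      have h := this.tendsto 0
      simp only [mul_zero, zero_add, one_pow, one_mul] at h
      exact h.mono_left nhdsWithin_le_nhds
    have hgw : Filter.Tendsto g (nhdsWithin 0 (Set.Ioi 0)) (nhds w) := by
      refine tendsto_of_tendsto_of_tendsto_of_le_of_le' tendsto_const_nhds hul ?_ ?_
      · filter_upwards [self_mem_nhdsWithin] with s hs using hlow s hs
      · filter_upwards [self_mem_nhdsWithin] with s hs using hupp s hs
    exact tendsto_nhds_unique hgc hgw
end

section
/- (Crofton formula in the Euclidean plane: the perimeter of a convex body equals π times its average width.) Let K ⊆ EuclideanSpace ℝ (Fin 2) be a compact convex set with nonempty interior. Then μH¹(frontier K) = (1/2) ∫_{v ∈ S¹} w_K(v) dμH¹(v), where w_K(v) = sup_{x ∈ K} ⟨x, v⟩ − inf_{x ∈ K} ⟨x, v⟩ is the width of K in direction v, S¹ = Metric.sphere (0 : EuclideanSpace ℝ (Fin 2)) 1, and μH¹ is the 1-dimensional Hausdorff measure. -/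
open MeasureTheory
open scoped RealInnerProductSpace MeasureTheory

namespace Crofton
open Set Filter Topology Real
open scoped ENNReal


/-- The mean of `|⟪x, v⟫|` over the circle is proportional to the norm of `x`. -/
lemma exists_const : ∃ c : ℝ≥0∞, ∀ x : (EuclideanSpace ℝ (Fin 2)),
    ∫⁻ v in Metric.sphere (0 : (EuclideanSpace ℝ (Fin 2))) 1, ‖⟪x, v⟫‖ₑ ∂μH[1] = c * ‖x‖ₑ := by
  obtain ⟨e, he⟩ : ∃ e : (EuclideanSpace ℝ (Fin 2)), ‖e‖ = 1 := ⟨EuclideanSpace.single 0 1, by simp⟩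
  refine ⟨∫⁻ v in Metric.sphere (0 : (EuclideanSpace ℝ (Fin 2))) 1, ‖⟪e, v⟫‖ₑ ∂μH[1], fun x => ?_⟩
  have hn : ‖x‖ = ‖‖x‖ • e‖ := by simp [norm_smul, he]
  set R := (ℝ ∙ (x - ‖x‖ • e))ᗮ.reflection with hR
  have hRx : R x = ‖x‖ • e := Submodule.reflection_sub hn
  have hmp := R.toIsometryEquiv.measurePreserving_hausdorffMeasure 1
  have hemb : MeasurableEmbedding R.toIsometryEquiv :=
    R.toIsometryEquiv.toHomeomorph.measurableEmbedding
  have h := hmp.setLIntegral_comp_preimage_emb hemb (fun v => ‖⟪‖x‖ • e, v⟫‖ₑ)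
    (Metric.sphere (0 : (EuclideanSpace ℝ (Fin 2))) 1)
  have hpre : R.toIsometryEquiv ⁻¹' (Metric.sphere (0 : (EuclideanSpace ℝ (Fin 2))) 1) = Metric.sphere (0 : (EuclideanSpace ℝ (Fin 2))) 1 := by
    ext v; simp
  rw [hpre] at h
  have h2 : ∀ v : (EuclideanSpace ℝ (Fin 2)), ‖⟪‖x‖ • e, R.toIsometryEquiv v⟫‖ₑ = ‖⟪x, v⟫‖ₑ := by
    intro v
    rw [← hRx]
    simp
  simp only [h2] at h
  rw [h]
  simp only [real_inner_smul_left, enorm_mul, enorm_norm]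
  rw [lintegral_const_mul' _ _ (by simp), mul_comm]

/-- Length of a curve is at least its chord. -/
lemma chord_le {γ : ℝ → (EuclideanSpace ℝ (Fin 2))} (hγ : Continuous γ) {a b : ℝ} (hab : a ≤ b) :
    ‖γ b - γ a‖ₑ ≤ μH[1] (γ '' Ioc a b) := by
  by_cases h0 : γ b - γ a = 0
  · simp [h0]
  set e : (EuclideanSpace ℝ (Fin 2)) := (‖γ b - γ a‖)⁻¹ • (γ b - γ a) with he
  have hne : ‖γ b - γ a‖ ≠ 0 := by simpa using h0
  have hen : ‖e‖ = 1 := by simp [he, norm_smul, hne]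
  have hlip : LipschitzWith 1 (fun x : (EuclideanSpace ℝ (Fin 2)) => ⟪e, x⟫) := by
    refine LipschitzWith.of_dist_le_mul fun x y => ?_
    rw [Real.dist_eq, ← inner_sub_right, dist_eq_norm]
    simpa [hen] using abs_real_inner_le_norm e (x - y)
  have h1 := hlip.hausdorffMeasure_image_le (d := 1) zero_le_one (γ '' Ioc a b)
  rw [hausdorffMeasure_real] at h1
  simp only [ENNReal.coe_one, ENNReal.one_rpow, one_mul] at h1
  refine le_trans ?_ h1
  rw [image_image]
  have hc : Continuous fun t => ⟪e, γ t⟫ := by fun_prop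
  have h2 := intermediate_value_Ioc hab (f := fun t => ⟪e, γ t⟫) hc.continuousOn
  refine le_trans (le_of_eq ?_) (measure_mono h2)
  rw [Real.volume_Ioc, ← inner_sub_right, he, real_inner_smul_left, real_inner_self_eq_norm_sq]
  rw [← ofReal_norm]
  congr 1
  field_simp

/-- Two points of the boundary on the same side of an interior point are equal. -/
lemma same_side {K : Set (EuclideanSpace ℝ (Fin 2))} (hconv : Convex ℝ K) {w x y e : (EuclideanSpace ℝ (Fin 2))} (hw : w ∈ interior K)
    (hx : x ∈ K) (hy : y ∈ K) (hx' : x ∉ interior K) (hy' : y ∉ interior K) {α β : ℝ}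
    (hα : x = w + α • e) (hβ : y = w + β • e) (h : 0 < α * β) : α = β := by
  by_contra hne
  have key : ∀ x y : (EuclideanSpace ℝ (Fin 2)), ∀ α β : ℝ, y ∈ K → x ∉ interior K → x = w + α • e → y = w + β • e →
      0 < α / β → α / β < 1 → False := by
    intro x y α β hy hx' hα hβ h0 h1
    apply hx'
    apply hconv.openSegment_interior_self_subset_interior hw hy
    refine ⟨1 - α / β, α / β, by linarith, h0, by ring, ?_⟩
    have hb : β ≠ 0 := by rintro rfl; simp at h0
    have : (α / β) • (β • e) = α • e := by rw [smul_smul]; congr 1; field_simp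
    rw [hβ, hα, smul_add, this, ← add_assoc, ← add_smul]
    simp
  have hb : β ≠ 0 := by rintro rfl; simp at h
  have ha : α ≠ 0 := by rintro rfl; simp at h
  have hd : 0 < α / β := by
    have : α / β = α * β / β ^ 2 := by field_simp
    rw [this]; positivity
  rcases lt_trichotomy (α / β) 1 with h1 | h1 | h1
  · exact key x y α β hy hx' hα hβ hd h1
  · exact hne ((div_eq_one_iff_eq hb).1 h1)
  · refine key y x β α hx hy' hβ hα ?_ ?_
    · rw [← inv_div]; positivity
    · rw [← inv_div]; exact inv_lt_one_of_one_lt₀ h1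

/-- A line through the interior meets the boundary in at most two points. -/
lemma three_points {K : Set (EuclideanSpace ℝ (Fin 2))} (hcomp : IsCompact K) (hconv : Convex ℝ K)
    (hint : (interior K).Nonempty) {v p q x y z : (EuclideanSpace ℝ (Fin 2))} {s : ℝ} (hp : p ∈ K) (hq : q ∈ K)
    (hps : ⟪p, v⟫ < s) (hqs : s < ⟪q, v⟫)
    (hx : x ∈ frontier K) (hy : y ∈ frontier K) (hz : z ∈ frontier K)
    (hxs : ⟪x, v⟫ = s) (hys : ⟪y, v⟫ = s) (hzs : ⟪z, v⟫ = s)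
    (hxy : x ≠ y) (hxz : x ≠ z) (hyz : y ≠ z) : False := by
  have hcl := hcomp.isClosed
  have hcli : closure (interior K) = K := by
    rw [hconv.closure_interior_eq_closure_of_nonempty_interior hint, hcl.closure_eq]
  have hf : Continuous fun x : (EuclideanSpace ℝ (Fin 2)) => ⟪x, v⟫ := by fun_prop
  obtain ⟨p', hp's, hp'⟩ : ∃ p', ⟪p', v⟫ < s ∧ p' ∈ interior K := by
    rw [← hcli] at hp
    exact mem_closure_iff.1 hp _ (isOpen_Iio.preimage hf) hps
  obtain ⟨q', hq's, hq'⟩ : ∃ p', s < ⟪p', v⟫ ∧ p' ∈ interior K := by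
    rw [← hcli] at hq
    exact mem_closure_iff.1 hq _ (isOpen_Ioi.preimage hf) hqs
  obtain ⟨w, hw, hws⟩ : ∃ w ∈ interior K, ⟪w, v⟫ = s := by
    have := hconv.interior.isPreconnected.intermediate_value hp' hq' hf.continuousOn
    exact this ⟨hp's.le, hq's.le⟩
  have hv : 0 < v 0 ^ 2 + v 1 ^ 2 := by
    by_contra hv
    have h0 : v 0 = 0 := by nlinarith [sq_nonneg (v 0), sq_nonneg (v 1)]
    have h1 : v 1 = 0 := by nlinarith [sq_nonneg (v 0), sq_nonneg (v 1)]
    have : v = 0 := by ext i; fin_cases i <;> simp [h0, h1]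
    subst this
    simp at hps hqs; linarith
  have hpar : ∀ x : (EuclideanSpace ℝ (Fin 2)), ⟪x, v⟫ = s → ∃ α : ℝ, x = w + α • (!₂[-v 1, v 0] : (EuclideanSpace ℝ (Fin 2))) := by
    intro x hx
    rw [← hws] at hx
    simp only [PiLp.inner_apply, Fin.sum_univ_two, RCLike.inner_apply, conj_trivial] at hx
    refine ⟨(-(x 0 - w 0) * v 1 + (x 1 - w 1) * v 0) / (v 0 ^ 2 + v 1 ^ 2), ?_⟩
    ext i
    fin_cases i
    · simp
      field_simp
      linear_combination (v 0) * hx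
    · simp
      field_simp
      linear_combination (v 1) * hx
  obtain ⟨a, ha⟩ := hpar x hxs
  obtain ⟨b, hb⟩ := hpar y hys
  obtain ⟨c, hc⟩ := hpar z hzs
  rw [hcl.frontier_eq] at hx hy hz
  have h1 : ¬ 0 < a * b := fun h => hxy <| by
    rw [ha, hb, same_side hconv hw hx.1 hy.1 hx.2 hy.2 ha hb h]
  have h2 : ¬ 0 < a * c := fun h => hxz <| by
    rw [ha, hc, same_side hconv hw hx.1 hz.1 hx.2 hz.2 ha hc h]
  have h3 : ¬ 0 < b * c := fun h => hyz <| by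
    rw [hb, hc, same_side hconv hw hy.1 hz.1 hy.2 hz.2 hb hc h]
  have a0 : a ≠ 0 := by rintro rfl; apply hx.2; rw [ha]; simpa using hw
  have b0 : b ≠ 0 := by rintro rfl; apply hy.2; rw [hb]; simpa using hw
  have c0 : c ≠ 0 := by rintro rfl; apply hz.2; rw [hc]; simpa using hw
  rcases lt_or_gt_of_ne a0 with ha | ha <;> rcases lt_or_gt_of_ne b0 with hb | hb <;>
  rcases lt_or_gt_of_ne c0 with hc | hc <;>
  first
  | exact h1 (mul_pos_of_neg_of_neg ha hb)
  | exact h1 (mul_pos ha hb)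
  | exact h2 (mul_pos_of_neg_of_neg ha hc)
  | exact h2 (mul_pos ha hc)
  | exact h3 (mul_pos_of_neg_of_neg hb hc)
  | exact h3 (mul_pos hb hc)

/-- Width. -/
noncomputable def width (K : Set (EuclideanSpace ℝ (Fin 2))) (v : (EuclideanSpace ℝ (Fin 2))) : ℝ :=
  sSup ((fun x => ⟪x, v⟫) '' K) - sInf ((fun x => ⟪x, v⟫) '' K)

lemma width_continuous {K : Set (EuclideanSpace ℝ (Fin 2))} (hcomp : IsCompact K) : Continuous (width K) := by
  have h : Continuous (Function.uncurry fun (v x : (EuclideanSpace ℝ (Fin 2))) => ⟪x, v⟫) := by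
    simp only [Function.uncurry_def]; fun_prop
  exact (hcomp.continuous_sSup h).sub (hcomp.continuous_sInf h)

lemma inner_mem {K : Set (EuclideanSpace ℝ (Fin 2))} (hcomp : IsCompact K) {x : (EuclideanSpace ℝ (Fin 2))} (hx : x ∈ K) (v : (EuclideanSpace ℝ (Fin 2))) :
    ⟪x, v⟫ ∈ Icc (sInf ((fun x => ⟪x, v⟫) '' K)) (sSup ((fun x => ⟪x, v⟫) '' K)) := by
  have hf : Continuous fun x : (EuclideanSpace ℝ (Fin 2)) => ⟪x, v⟫ := by fun_prop
  have hK := hcomp.image hf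
  exact ⟨csInf_le hK.bddBelow (mem_image_of_mem _ hx), le_csSup hK.bddAbove (mem_image_of_mem _ hx)⟩

lemma inner_abs_le_width {K : Set (EuclideanSpace ℝ (Fin 2))} (hcomp : IsCompact K) {x y : (EuclideanSpace ℝ (Fin 2))} (hx : x ∈ K) (hy : y ∈ K)
    (v : (EuclideanSpace ℝ (Fin 2))) : |⟪x - y, v⟫| ≤ width K v := by
  have h1 := inner_mem hcomp hx v
  have h2 := inner_mem hcomp hy v
  rw [inner_sub_left, width, abs_le]
  constructor <;> linarith [h1.1, h1.2, h2.1, h2.2]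

/-- The total variation of a linear functional along the boundary is at most twice the width. -/
lemma variation_le {K : Set (EuclideanSpace ℝ (Fin 2))} (hcomp : IsCompact K) (hconv : Convex ℝ K)
    (hint : (interior K).Nonempty) {γ : ℝ → (EuclideanSpace ℝ (Fin 2))} (hγ : Continuous γ)
    (hinj : InjOn γ (Ioc (-π) π)) (hmem : ∀ t, γ t ∈ frontier K)
    {ι : Type*} [Fintype ι] (a b : ι → ℝ) (hab : ∀ i, a i ≤ b i)
    (hsub : ∀ i, Ioo (a i) (b i) ⊆ Ioc (-π) π)
    (hdisj : Pairwise fun i j => Disjoint (Ioo (a i) (b i)) (Ioo (a j) (b j))) (v : (EuclideanSpace ℝ (Fin 2))) :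
    ∑ i, ‖⟪γ (b i) - γ (a i), v⟫‖ₑ ≤ 2 * ENNReal.ofReal (width K v) := by
  classical
  set f : ℝ → ℝ := fun t => ⟪γ t, v⟫ with hf
  have hfc : Continuous f := by fun_prop
  have hK : ∀ t, γ t ∈ K := fun t => hcomp.isClosed.frontier_subset (hmem t)
  set I := sInf ((fun x => ⟪x, v⟫) '' K)
  set S := sSup ((fun x => ⟪x, v⟫) '' K)
  have h1 : ∀ i, ‖⟪γ (b i) - γ (a i), v⟫‖ₑ
      = ∫⁻ s, (uIoo (f (a i)) (f (b i))).indicator 1 s := by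
    intro i
    rw [lintegral_indicator_one (by exact measurableSet_Ioo), Real.volume_uIoo, inner_sub_left,
      Real.enorm_eq_ofReal_abs]
  have h2 : 2 * ENNReal.ofReal (width K v) = ∫⁻ s, (Ioo I S).indicator (fun _ => 2) s := by
    rw [lintegral_indicator_const measurableSet_Ioo, Real.volume_Ioo]; rfl
  simp_rw [h1]
  rw [h2, ← lintegral_finsetSum]
  swap
  · intro i _
    exact (measurable_one).indicator measurableSet_Ioo
  refine lintegral_mono fun s => ?_
  have hmemS : ∀ i, s ∈ uIoo (f (a i)) (f (b i)) → s ∈ Ioo I S ∧ ∃ t ∈ Ioo (a i) (b i), f t = s ∧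
      ∃ p ∈ K, ∃ q ∈ K, ⟪p, v⟫ < s ∧ s < ⟪q, v⟫ := by
    intro i hi
    have hA := inner_mem hcomp (hK (a i)) v
    have hB := inner_mem hcomp (hK (b i)) v
    rcases le_total (f (a i)) (f (b i)) with h | h
    · rw [uIoo_of_le h] at hi
      obtain ⟨t, ht, hts⟩ := intermediate_value_Ioo (hab i) hfc.continuousOn hi
      exact ⟨⟨hA.1.trans_lt hi.1, hi.2.trans_le hB.2⟩, t, ht, hts, _, hK (a i), _, hK (b i), hi⟩
    · rw [uIoo_of_ge h] at hi
      obtain ⟨t, ht, hts⟩ := intermediate_value_Ioo' (hab i) hfc.continuousOn hi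
      exact ⟨⟨hB.1.trans_lt hi.1, hi.2.trans_le hA.2⟩, t, ht, hts, _, hK (b i), _, hK (a i), hi⟩
  have hcount : ∑ i, (uIoo (f (a i)) (f (b i))).indicator (1 : ℝ → ℝ≥0∞) s
      = ((Finset.univ.filter fun i => s ∈ uIoo (f (a i)) (f (b i))).card : ℝ≥0∞) := by
    simp [indicator_apply, Finset.sum_boole]
  rw [hcount]
  by_cases hs : s ∈ Ioo I S
  · rw [indicator_of_mem hs]
    have : (Finset.univ.filter fun i => s ∈ uIoo (f (a i)) (f (b i))).card ≤ 2 := by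
      by_contra! hc
      obtain ⟨i, hi, j, hj, k, hk, hij, hik, hjk⟩ := Finset.two_lt_card.1 hc
      simp only [Finset.mem_filter, Finset.mem_univ, true_and] at hi hj hk
      obtain ⟨-, t1, ht1, hf1, p, hp, q, hq, hps, hqs⟩ := hmemS i hi
      obtain ⟨-, t2, ht2, hf2, -⟩ := hmemS j hj
      obtain ⟨-, t3, ht3, hf3, -⟩ := hmemS k hk
      have hd : ∀ i j t t', i ≠ j → t ∈ Ioo (a i) (b i) → t' ∈ Ioo (a j) (b j) → γ t ≠ γ t' := by
        intro i j t t' hij ht ht' h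
        have := hinj (hsub i ht) (hsub j ht') h
        subst this
        exact Set.disjoint_left.1 (hdisj hij) ht ht'
      exact three_points hcomp hconv hint hp hq hps hqs (hmem t1) (hmem t2) (hmem t3) hf1 hf2 hf3
        (hd _ _ _ _ hij ht1 ht2) (hd _ _ _ _ hik ht1 ht3) (hd _ _ _ _ hjk ht2 ht3)
    change _ ≤ (2 : ℝ≥0∞)
    exact_mod_cast this
  · rw [indicator_of_notMem hs, Finset.filter_false_of_mem]
    · simp
    · intro i _ hi
      exact hs (hmemS i hi).1

/-- The uniform grid. -/
noncomputable def grid (n i : ℕ) : ℝ := -π + 2 * π * (i / (n + 1))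

lemma grid_zero (n : ℕ) : grid n 0 = -π := by simp [grid]

lemma grid_last (n : ℕ) : grid n (n + 1) = π := by
  have : (n : ℝ) + 1 ≠ 0 := by positivity
  simp only [grid]; push_cast; field_simp; ring

lemma grid_mono (n : ℕ) : Monotone (grid n) := by
  intro i j hij
  have : (i : ℝ) ≤ j := by exact_mod_cast hij
  have := pi_pos
  unfold grid
  gcongr

lemma grid_succ_sub (n i : ℕ) : grid n (i + 1) - grid n i = 2 * π / (n + 1) := by
  have : (n : ℝ) + 1 ≠ 0 := by positivity
  simp only [grid]; push_cast; field_simp; ring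

lemma grid_sub (n i : ℕ) (hi : i < n + 1) :
    Icc (grid n i) (grid n (i + 1)) ⊆ Icc (-π) π := by
  rw [← grid_zero n, ← grid_last n]
  exact Icc_subset_Icc (grid_mono n (Nat.zero_le _)) (grid_mono n hi)

lemma mesh_tendsto : Tendsto (fun n : ℕ => 2 * π / ((n : ℝ) + 1)) atTop (𝓝 0) := by
  have := tendsto_one_div_add_atTop_nhds_zero_nat (𝕜 := ℝ)
  simpa [div_eq_mul_inv] using this.const_mul (2 * π)

lemma grid_disj (n : ℕ) {i j : ℕ} (h : i ≠ j) :
    Disjoint (Ioc (grid n i) (grid n (i + 1))) (Ioc (grid n j) (grid n (j + 1))) := by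
  rw [Set.disjoint_left]
  intro x hi hj
  rcases lt_or_gt_of_ne h with h | h
  · exact absurd (hi.2.trans (grid_mono n h)) (not_le.2 hj.1)
  · exact absurd (hj.2.trans (grid_mono n h)) (not_le.2 hi.1)

lemma exists_grid (n : ℕ) {θ : ℝ} (hθ : θ ∈ Ioc (-π) π) :
    ∃ i < n + 1, θ ∈ Icc (grid n i) (grid n (i + 1)) := by
  by_contra! h
  have : ∀ i ≤ n + 1, grid n i < θ := by
    intro i
    induction i with
    | zero => intro _; rw [grid_zero]; exact hθ.1
    | succ i ih =>
      intro hi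
      have h1 := ih (by omega)
      by_contra! h2
      exact h i (by omega) ⟨h1.le, h2⟩
  have := this (n + 1) le_rfl
  rw [grid_last] at this
  exact absurd hθ.2 (not_le.2 this)

lemma exists_ediam {γ : ℝ → (EuclideanSpace ℝ (Fin 2))} (hγ : Continuous γ) {s t : ℝ} (hst : s ≤ t) :
    ∃ a b, s ≤ a ∧ a ≤ b ∧ b ≤ t ∧ Metric.ediam (γ '' Icc s t) ≤ ‖γ b - γ a‖ₑ := by
  have hc : IsCompact (Icc s t ×ˢ Icc s t) := isCompact_Icc.prod isCompact_Icc
  obtain ⟨⟨x, y⟩, ⟨hx, hy⟩, hmax⟩ := hc.exists_isMaxOn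
    ⟨(s, s), ⟨left_mem_Icc.2 hst, left_mem_Icc.2 hst⟩⟩
    (f := fun p : ℝ × ℝ => edist (γ p.1) (γ p.2)) (by fun_prop)
  have hd : Metric.ediam (γ '' Icc s t) ≤ edist (γ x) (γ y) := by
    refine Metric.ediam_image_le_iff.2 ?_
    intro a ha b hb
    exact isMaxOn_iff.1 hmax (a, b) (Set.mk_mem_prod ha hb)
  rcases le_total x y with h | h
  · exact ⟨x, y, hx.1, h, hy.2, by rwa [← edist_eq_enorm_sub, edist_comm]⟩
  · exact ⟨y, x, hy.1, h, hx.2, by rwa [← edist_eq_enorm_sub]⟩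

lemma upper {K : Set (EuclideanSpace ℝ (Fin 2))} (hcomp : IsCompact K) (hconv : Convex ℝ K)
    (hint : (interior K).Nonempty) {γ : ℝ → (EuclideanSpace ℝ (Fin 2))} (hγ : Continuous γ)
    (hinj : InjOn γ (Ioc (-π) π)) (hmem : ∀ t, γ t ∈ frontier K)
    (himg : frontier K ⊆ γ '' Ioc (-π) π)
    {c : ℝ≥0∞} (hc : ∀ x : (EuclideanSpace ℝ (Fin 2)),
      ∫⁻ v in Metric.sphere (0 : (EuclideanSpace ℝ (Fin 2))) 1, ‖⟪x, v⟫‖ₑ ∂μH[1] = c * ‖x‖ₑ) :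
    c * μH[1] (frontier K) ≤
      2 * ∫⁻ v in Metric.sphere (0 : (EuclideanSpace ℝ (Fin 2))) 1, ENNReal.ofReal (width K v) ∂μH[1] := by
  set B := 2 * ∫⁻ v in Metric.sphere (0 : (EuclideanSpace ℝ (Fin 2))) 1, ENNReal.ofReal (width K v) ∂μH[1] with hB
  set T : ∀ n : ℕ, Fin (n + 1) → Set (EuclideanSpace ℝ (Fin 2)) := fun n i => γ '' Icc (grid n i) (grid n (i + 1)) with hT
  have hsum : ∀ n, c * ∑ i, Metric.ediam (T n i) ≤ B := by
    intro n
    choose a b h1 h2 h3 h4 using fun i : Fin (n + 1) =>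
      exists_ediam hγ (grid_mono n (Nat.le_succ (i : ℕ)))
    calc c * ∑ i, Metric.ediam (T n i) ≤ c * ∑ i, ‖γ (b i) - γ (a i)‖ₑ := by
          gcongr with i; exact h4 i
      _ = ∫⁻ v in Metric.sphere (0 : (EuclideanSpace ℝ (Fin 2))) 1, ∑ i, ‖⟪γ (b i) - γ (a i), v⟫‖ₑ ∂μH[1] := by
          rw [lintegral_finsetSum, Finset.mul_sum]
          · simp_rw [hc]
          · intro i _
            exact Continuous.measurable (by fun_prop)
      _ ≤ ∫⁻ v in Metric.sphere (0 : (EuclideanSpace ℝ (Fin 2))) 1, 2 * ENNReal.ofReal (width K v) ∂μH[1] := by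
          refine lintegral_mono fun v => ?_
          have hs : ∀ i, Ioo (a i) (b i) ⊆ Ioc (grid n i) (grid n (i + 1)) := fun i x hx =>
            ⟨(h1 i).trans_lt hx.1, hx.2.le.trans (h3 i)⟩
          refine variation_le hcomp hconv hint hγ hinj hmem a b h2 (fun i => ?_) ?_ v
          · refine (hs i).trans ?_
            rw [← grid_zero n, ← grid_last n]
            exact Ioc_subset_Ioc (grid_mono n (Nat.zero_le _)) (grid_mono n i.2)
          · intro i j hij
            exact (grid_disj n (fun h => hij (Fin.ext h))).mono (hs i) (hs j)
      _ = B := by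
          rw [hB, lintegral_const_mul]
          exact (width_continuous hcomp).measurable.ennreal_ofReal
  have hH : μH[1] (frontier K) ≤ liminf (fun n => ∑ i, Metric.ediam (T n i) ^ (1 : ℝ)) atTop := by
    refine Measure.hausdorffMeasure_le_liminf_sum 1 (frontier K)
      (fun n => ⨆ i, Metric.ediam (T n i)) ?_ T ?_ ?_
    · rw [ENNReal.tendsto_nhds_zero]
      intro ε hε
      have huc := isCompact_Icc.uniformContinuousOn_of_continuous
        (hγ.continuousOn (s := Icc (-π) π))
      rw [EMetric.uniformContinuousOn_iff] at huc
      obtain ⟨δ, hδ, H⟩ := huc ε hε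
      have hm : Tendsto (fun n : ℕ => ENNReal.ofReal (2 * π / ((n : ℝ) + 1))) atTop (𝓝 0) := by
        simpa using ENNReal.tendsto_ofReal mesh_tendsto
      filter_upwards [hm.eventually_lt_const hδ] with n hn
      refine iSup_le fun i => ?_
      rw [hT, Metric.ediam_image_le_iff]
      intro x hx y hy
      refine (H (grid_sub n i i.2 hx) (grid_sub n i i.2 hy) (lt_of_le_of_lt ?_ hn)).le
      rw [edist_dist, ← grid_succ_sub n i]
      exact ENNReal.ofReal_le_ofReal (Real.dist_le_of_mem_Icc hx hy)
    · exact Eventually.of_forall fun n i => le_iSup (fun i => Metric.ediam (T n i)) i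
    · refine Eventually.of_forall fun n x hx => ?_
      obtain ⟨θ, hθ, rfl⟩ := himg hx
      obtain ⟨i, hi, hθi⟩ := exists_grid n hθ
      exact mem_iUnion.2 ⟨⟨i, hi⟩, mem_image_of_mem _ hθi⟩
  simp only [ENNReal.rpow_one] at hH
  obtain ⟨N, hN⟩ : ∃ N : ℕ → ℝ≥0∞, N = fun n => ∑ i, Metric.ediam (T n i) := ⟨_, rfl⟩
  rw [← hN] at hH
  have hle : liminf N atTop ≤ ⨆ n, N n :=
    liminf_le_of_le (by isBoundedDefault) (fun b hb => by
      obtain ⟨n, hn⟩ := hb.exists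
      exact hn.trans (le_iSup N n))
  calc c * μH[1] (frontier K) ≤ c * ⨆ n, N n := by gcongr; exact hH.trans hle
    _ = ⨆ n, c * N n := ENNReal.mul_iSup _ _
    _ ≤ B := iSup_le fun n => by rw [hN]; exact hsum n

lemma cyclic_sum (g : ℕ → ℝ) (N : ℕ) (h0 : g 0 = g N) {j k : ℕ} (hj : j ≤ N) (hk : k ≤ N) :
    2 * |g j - g k| ≤ ∑ i ∈ Finset.range N, |g (i + 1) - g i| := by
  wlog hjk : j ≤ k generalizing j k
  · rw [abs_sub_comm]; exact this hk hj (by omega)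
  have h1 := dist_le_Ico_sum_dist g (Nat.zero_le j)
  have h2 := dist_le_Ico_sum_dist g hjk
  have h3 := dist_le_Ico_sum_dist g hk
  have hs : ∑ i ∈ Finset.range N, |g (i + 1) - g i| = ∑ i ∈ Finset.Ico 0 N, dist (g i) (g (i + 1)) := by
    rw [Finset.range_eq_Ico]
    refine Finset.sum_congr rfl fun i _ => ?_
    rw [dist_comm, Real.dist_eq]
  rw [hs, ← Finset.sum_Ico_consecutive _ (Nat.zero_le k) hk,
    ← Finset.sum_Ico_consecutive _ (Nat.zero_le j) hjk]
  have h4 := dist_triangle (g j) (g 0) (g k)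
  rw [dist_comm (g j) (g 0)] at h4
  rw [← h0, dist_comm] at h3
  rw [← Real.dist_eq]
  linarith

lemma exists_max {K : Set (EuclideanSpace ℝ (Fin 2))} (hcomp : IsCompact K) (hne : K.Nonempty) {v : (EuclideanSpace ℝ (Fin 2))} (hv : ‖v‖ = 1) :
    ∃ x ∈ frontier K, ⟪x, v⟫ = sSup ((fun x => ⟪x, v⟫) '' K) := by
  have hf : Continuous fun x : (EuclideanSpace ℝ (Fin 2)) => ⟪x, v⟫ := by fun_prop
  obtain ⟨x, hx, hxs⟩ := hcomp.exists_sSup_image_eq hne hf.continuousOn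
  refine ⟨x, ?_, hxs.symm⟩
  rw [hcomp.isClosed.frontier_eq]
  refine ⟨hx, fun hxi => ?_⟩
  have hc : Continuous fun t : ℝ => x + t • v := by fun_prop
  have h1 : ∀ᶠ t in 𝓝 (0 : ℝ), x + t • v ∈ interior K :=
    hc.continuousAt.eventually (isOpen_interior.mem_nhds (by simpa using hxi))
  have h2 : ∀ᶠ t in 𝓝[>] (0 : ℝ), x + t • v ∈ interior K := nhdsWithin_le_nhds h1
  obtain ⟨t, ht, ht0⟩ := (h2.and self_mem_nhdsWithin).exists
  have h3 := (inner_mem hcomp (interior_subset ht) v).2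
  rw [hxs, inner_add_left, real_inner_smul_left, real_inner_self_eq_norm_sq, hv] at h3
  have : (0 : ℝ) < t := ht0
  linarith

lemma exists_min {K : Set (EuclideanSpace ℝ (Fin 2))} (hcomp : IsCompact K) (hne : K.Nonempty) {v : (EuclideanSpace ℝ (Fin 2))} (hv : ‖v‖ = 1) :
    ∃ x ∈ frontier K, ⟪x, v⟫ = sInf ((fun x => ⟪x, v⟫) '' K) := by
  obtain ⟨x, hx, hxs⟩ := exists_max hcomp hne (v := -v) (by simpa using hv)
  refine ⟨x, hx, ?_⟩
  have hxK := hcomp.isClosed.frontier_subset hx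
  have hL : IsLeast ((fun x => ⟪x, v⟫) '' K) ⟪x, v⟫ := by
    refine ⟨mem_image_of_mem _ hxK, ?_⟩
    rintro _ ⟨y, hy, rfl⟩
    have := (inner_mem hcomp hy (-v)).2
    rw [← hxs, inner_neg_right, inner_neg_right] at this
    simpa using this
  exact hL.csInf_eq.symm

lemma grid_approx {θ : ℝ} (hθ : θ ∈ Ioc (-π) π) : ∃ j : ℕ → ℕ, (∀ n, j n ≤ n + 1) ∧
    Tendsto (fun n => grid n (j n)) atTop (𝓝 θ) := by
  choose j hj hjm using fun n => exists_grid n hθ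
  refine ⟨j, fun n => (hj n).le, ?_⟩
  rw [tendsto_iff_dist_tendsto_zero]
  refine squeeze_zero (fun _ => dist_nonneg) (fun n => ?_) mesh_tendsto
  rw [← grid_succ_sub n (j n)]
  exact Real.dist_le_of_mem_Icc (left_mem_Icc.2 (grid_mono n (Nat.le_succ _))) (hjm n)

lemma lower {K : Set (EuclideanSpace ℝ (Fin 2))} (hcomp : IsCompact K)
    (hne : K.Nonempty) {γ : ℝ → (EuclideanSpace ℝ (Fin 2))} (hγ : Continuous γ)
    (hinj : InjOn γ (Ioc (-π) π)) (hmem : ∀ t, γ t ∈ frontier K)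
    (himg : frontier K ⊆ γ '' Ioc (-π) π) (hper : γ (-π) = γ π)
    {c : ℝ≥0∞} (hc : ∀ x : (EuclideanSpace ℝ (Fin 2)),
      ∫⁻ v in Metric.sphere (0 : (EuclideanSpace ℝ (Fin 2))) 1, ‖⟪x, v⟫‖ₑ ∂μH[1] = c * ‖x‖ₑ) :
    2 * ∫⁻ v in Metric.sphere (0 : (EuclideanSpace ℝ (Fin 2))) 1, ENNReal.ofReal (width K v) ∂μH[1] ≤
      c * μH[1] (frontier K) := by
  set F : ℕ → (EuclideanSpace ℝ (Fin 2)) → ℝ≥0∞ := fun n v =>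
    ∑ i ∈ Finset.range (n + 1), ‖⟪γ (grid n (i + 1)) - γ (grid n i), v⟫‖ₑ with hF
  have hFm : ∀ n, Measurable (F n) := fun n => by
    refine Finset.measurable_fun_sum _ fun i _ => Continuous.measurable (by fun_prop)
  have hFi : ∀ n, ∫⁻ v in Metric.sphere (0 : (EuclideanSpace ℝ (Fin 2))) 1, F n v ∂μH[1] ≤ c * μH[1] (frontier K) := by
    intro n
    rw [hF, lintegral_finsetSum]
    swap
    · intro i _; exact Continuous.measurable (by fun_prop)
    simp_rw [hc]
    rw [← Finset.mul_sum]
    gcongr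
    have hIoc : ∀ i ∈ Finset.range (n + 1), Ioc (grid n i) (grid n (i + 1)) ⊆ Ioc (-π) π := by
      intro i hi
      rw [← grid_zero n, ← grid_last n]
      exact Ioc_subset_Ioc (grid_mono n (Nat.zero_le _)) (grid_mono n (Finset.mem_range.1 hi))
    calc ∑ i ∈ Finset.range (n + 1), ‖γ (grid n (i + 1)) - γ (grid n i)‖ₑ
        ≤ ∑ i ∈ Finset.range (n + 1), μH[1] (γ '' Ioc (grid n i) (grid n (i + 1))) :=
          Finset.sum_le_sum fun i _ => chord_le hγ (grid_mono n (Nat.le_succ i))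
      _ = μH[1] (⋃ i ∈ Finset.range (n + 1), γ '' Ioc (grid n i) (grid n (i + 1))) := by
          rw [measure_biUnion_finset]
          · intro i hi j hj hij
            refine Set.disjoint_left.2 ?_
            rintro _ ⟨x, hx, rfl⟩ ⟨y, hy, hxy⟩
            have := hinj (hIoc j hj hy) (hIoc i hi hx) hxy
            subst this
            exact Set.disjoint_left.1 (grid_disj n hij) hx hy
          · intro i hi
            exact measurableSet_Ioc.image_of_continuousOn_injOn hγ.continuousOn
              (hinj.mono (hIoc i hi))
      _ ≤ μH[1] (frontier K) := by
          refine measure_mono (iUnion₂_subset fun i _ => ?_)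
          rintro _ ⟨t, -, rfl⟩
          exact hmem t
  have hpt : ∀ v ∈ Metric.sphere (0 : (EuclideanSpace ℝ (Fin 2))) 1,
      2 * ENNReal.ofReal (width K v) ≤ liminf (fun n => F n v) atTop := by
    intro v hv
    have hv1 : ‖v‖ = 1 := by simpa using hv
    obtain ⟨x, hx, hxs⟩ := exists_max hcomp hne hv1
    obtain ⟨y, hy, hys⟩ := exists_min hcomp hne hv1
    obtain ⟨θ, hθ, rfl⟩ := himg hx
    obtain ⟨φ, hφ, rfl⟩ := himg hy
    obtain ⟨j, hj, hjt⟩ := grid_approx hθ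
    obtain ⟨k, hk, hkt⟩ := grid_approx hφ
    have hf : Continuous fun t => ⟪γ t, v⟫ := by fun_prop
    have hlim := (((hf.tendsto θ).comp hjt).sub ((hf.tendsto φ).comp hkt)).abs.const_mul 2
    have hlim2 := ENNReal.tendsto_ofReal hlim
    have hw : ENNReal.ofReal (2 * |⟪γ θ, v⟫ - ⟪γ φ, v⟫|) = 2 * ENNReal.ofReal (width K v) := by
      rw [hxs, hys, ENNReal.ofReal_mul (by norm_num), ← width, abs_of_nonneg]
      · simp
      · exact (abs_nonneg _).trans (inner_abs_le_width hcomp hne.some_mem hne.some_mem v)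
    rw [hw] at hlim2
    rw [← hlim2.liminf_eq]
    refine liminf_le_liminf (Eventually.of_forall fun n => ?_)
    have := cyclic_sum (fun i => ⟪γ (grid n i), v⟫) (n + 1)
      (by simp only [grid_zero, grid_last, hper]) (hj n) (hk n)
    refine (ENNReal.ofReal_le_ofReal this).trans (le_of_eq ?_)
    rw [ENNReal.ofReal_sum_of_nonneg (fun _ _ => abs_nonneg _)]
    refine Finset.sum_congr rfl fun i _ => ?_
    rw [inner_sub_left, Real.enorm_eq_ofReal_abs]
  rw [← lintegral_const_mul _ (width_continuous hcomp).measurable.ennreal_ofReal]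
  calc ∫⁻ v in Metric.sphere (0 : (EuclideanSpace ℝ (Fin 2))) 1, 2 * ENNReal.ofReal (width K v) ∂μH[1]
      ≤ ∫⁻ v in Metric.sphere (0 : (EuclideanSpace ℝ (Fin 2))) 1, liminf (fun n => F n v) atTop ∂μH[1] :=
        setLIntegral_mono' Metric.isClosed_sphere.measurableSet hpt
    _ ≤ liminf (fun n => ∫⁻ v in Metric.sphere (0 : (EuclideanSpace ℝ (Fin 2))) 1, F n v ∂μH[1]) atTop :=
        lintegral_liminf_le hFm
    _ ≤ c * μH[1] (frontier K) :=
        liminf_le_of_le (by isBoundedDefault) (fun b hb => by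
          obtain ⟨n, hn⟩ := hb.exists
          exact hn.trans (hFi n))

/-- Standard parametrization of the circle. -/
noncomputable def circ (t : ℝ) : (EuclideanSpace ℝ (Fin 2)) := Complex.orthonormalBasisOneI.repr (Circle.exp t : ℂ)

lemma circ_lip : LipschitzWith 1 circ := by
  refine LipschitzWith.of_dist_le_mul fun x y => ?_
  unfold circ
  rw [LinearIsometryEquiv.dist_map, Circle.coe_exp, Circle.coe_exp, dist_eq_norm]
  have h : Complex.exp (x * Complex.I) - Complex.exp (y * Complex.I)
      = Complex.exp (y * Complex.I) * (Complex.exp (Complex.I * ((x - y : ℝ) : ℂ)) - 1) := by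
    rw [mul_sub, ← Complex.exp_add]
    push_cast
    ring_nf
  rw [h, norm_mul, Complex.norm_exp_ofReal_mul_I]
  simpa [dist_eq_norm] using Real.norm_exp_I_mul_ofReal_sub_one_le (x := x - y)

lemma circ_mem (t : ℝ) : circ t ∈ Metric.sphere (0 : (EuclideanSpace ℝ (Fin 2))) 1 := by
  simp [circ]

lemma circ_inj : InjOn circ (Ioc (-π) π) := by
  intro x hx y hy h
  have h1 : Circle.exp x = Circle.exp y := by
    apply Circle.ext
    exact Complex.orthonormalBasisOneI.repr.injective h
  exact Circle.exp_injOn_Ioc (by linarith) hx hy h1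

lemma circ_img : Metric.sphere (0 : (EuclideanSpace ℝ (Fin 2))) 1 ⊆ circ '' Ioc (-π) π := by
  intro v hv
  set z := Complex.orthonormalBasisOneI.repr.symm v with hz
  have hz1 : ‖z‖ = 1 := by
    rw [hz, LinearIsometryEquiv.norm_map]; simpa using hv
  let w : Circle := ⟨z, by simpa [Submonoid.unitSphere] using hz1⟩
  refine ⟨Complex.arg z, Complex.arg_mem_Ioc z, ?_⟩
  have : Circle.exp (Complex.arg (w : ℂ)) = w := Circle.exp_arg w
  have h2 : (Circle.exp (Complex.arg z) : ℂ) = z := congrArg Subtype.val this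
  rw [circ, h2, hz, LinearIsometryEquiv.apply_symm_apply]

lemma circ_per : circ (-π) = circ π := by
  have := Circle.exp_add_two_pi (-π)
  rw [show -π + 2 * π = π by ring] at this
  rw [circ, circ, this]

lemma main_c {K : Set (EuclideanSpace ℝ (Fin 2))} (hcomp : IsCompact K) (hconv : Convex ℝ K)
    (hint : (interior K).Nonempty)
    {c : ℝ≥0∞} (hc : ∀ x : (EuclideanSpace ℝ (Fin 2)),
      ∫⁻ v in Metric.sphere (0 : (EuclideanSpace ℝ (Fin 2))) 1, ‖⟪x, v⟫‖ₑ ∂μH[1] = c * ‖x‖ₑ) :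
    c * μH[1] (frontier K) =
      2 * ∫⁻ v in Metric.sphere (0 : (EuclideanSpace ℝ (Fin 2))) 1, ENNReal.ofReal (width K v) ∂μH[1] := by
  obtain ⟨h, -, -, hfr⟩ := exists_homeomorph_image_interior_closure_frontier_eq_unitBall hconv hint
    hcomp.isBounded
  have hfr' : ∀ x, h x ∈ Metric.sphere (0 : (EuclideanSpace ℝ (Fin 2))) 1 ↔ x ∈ frontier K := by
    intro x; rw [← hfr]; exact h.injective.mem_set_image
  set γ : ℝ → (EuclideanSpace ℝ (Fin 2)) := fun t => h.symm (circ t) with hγd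
  have hγ : Continuous γ := h.symm.continuous.comp circ_lip.continuous
  have hinj : InjOn γ (Ioc (-π) π) := h.symm.injective.comp_injOn circ_inj
  have hmem : ∀ t, γ t ∈ frontier K := fun t => by
    rw [← hfr', hγd, h.apply_symm_apply]; exact circ_mem t
  have himg : frontier K ⊆ γ '' Ioc (-π) π := by
    intro x hx
    obtain ⟨t, ht, hx'⟩ := circ_img ((hfr' x).2 hx)
    exact ⟨t, ht, by simp [hγd, hx']⟩
  exact le_antisymm (upper hcomp hconv hint hγ hinj hmem himg hc)
    (lower hcomp (hint.mono interior_subset) hγ hinj hmem himg (by simp [hγd, circ_per]) hc)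

lemma sphere_ne_top : μH[1] (Metric.sphere (0 : (EuclideanSpace ℝ (Fin 2))) 1) ≠ ∞ := by
  have h := circ_lip.hausdorffMeasure_image_le (d := 1) zero_le_one (Ioc (-π) π)
  rw [hausdorffMeasure_real] at h
  refine ((measure_mono circ_img).trans h).trans_lt ?_ |>.ne
  simp

lemma sphere_ne_zero : μH[1] (Metric.sphere (0 : (EuclideanSpace ℝ (Fin 2))) 1) ≠ 0 := by
  have h := chord_le circ_lip.continuous pi_pos.le
  have h2 : μH[1] (circ '' Ioc 0 π) ≤ μH[1] (Metric.sphere (0 : (EuclideanSpace ℝ (Fin 2))) 1) :=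
    measure_mono (by rintro _ ⟨t, -, rfl⟩; exact circ_mem t)
  intro h0
  rw [h0] at h2
  have h3 : circ π - circ 0 = 0 := by
    simpa using h.trans h2
  have := circ_inj ⟨by linarith [pi_pos], le_rfl⟩ ⟨by linarith [pi_pos], pi_pos.le⟩
    (sub_eq_zero.1 h3)
  exact pi_pos.ne' this

lemma width_ball {v : (EuclideanSpace ℝ (Fin 2))} (hv : ‖v‖ = 1) : width (Metric.closedBall 0 1) v = 2 := by
  have hle : ∀ x ∈ Metric.closedBall (0 : (EuclideanSpace ℝ (Fin 2))) 1, |⟪x, v⟫| ≤ 1 := by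
    intro x hx
    have := abs_real_inner_le_norm x v
    rw [hv, mul_one] at this
    exact this.trans (by simpa using hx)
  have hvv : ⟪v, v⟫ = 1 := by rw [real_inner_self_eq_norm_sq, hv]; norm_num
  have h1 : IsGreatest ((fun x => ⟪x, v⟫) '' Metric.closedBall (0 : (EuclideanSpace ℝ (Fin 2))) 1) 1 :=
    ⟨⟨v, by simp [hv], hvv⟩, by rintro _ ⟨x, hx, rfl⟩; exact (abs_le.1 (hle x hx)).2⟩
  have h2 : IsLeast ((fun x => ⟪x, v⟫) '' Metric.closedBall (0 : (EuclideanSpace ℝ (Fin 2))) 1) (-1) :=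
    ⟨⟨-v, by simp [hv], by simp [inner_neg_left, hv]⟩,
      by rintro _ ⟨x, hx, rfl⟩; exact (abs_le.1 (hle x hx)).1⟩
  rw [width, h1.csSup_eq, h2.csInf_eq]
  norm_num

lemma const_eq {c : ℝ≥0∞} (hc : ∀ x : (EuclideanSpace ℝ (Fin 2)),
      ∫⁻ v in Metric.sphere (0 : (EuclideanSpace ℝ (Fin 2))) 1, ‖⟪x, v⟫‖ₑ ∂μH[1] = c * ‖x‖ₑ) : c = 4 := by
  have h := main_c (isCompact_closedBall (0 : (EuclideanSpace ℝ (Fin 2))) 1) (convex_closedBall 0 1)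
    ⟨0, by rw [interior_closedBall _ one_ne_zero]; simp⟩ hc
  rw [frontier_closedBall _ one_ne_zero,
    setLIntegral_congr_fun (g := fun _ => 2) Metric.isClosed_sphere.measurableSet
      (fun v hv => by
        dsimp only
        rw [width_ball (by simpa using hv)]; simp), setLIntegral_const, ← mul_assoc] at h
  have := (ENNReal.mul_left_inj sphere_ne_zero sphere_ne_top).1 h
  rw [this]; norm_num

end Crofton



/-- Crofton formula in the Euclidean plane: the perimeter of a planar convex body
equals half the integral of its width over the unit circle, i.e. `π` times its
average width. The width of `K` in direction `v` is
`sup_{x ∈ K} ⟪x, v⟫ - inf_{x ∈ K} ⟪x, v⟫`. -/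
theorem crofton_perimeter_eq_average_width
    (K : Set (EuclideanSpace ℝ (Fin 2)))
    (hcomp : IsCompact K) (hconv : Convex ℝ K) (hint : (interior K).Nonempty) :
    μH[1] (frontier K)
      = ENNReal.ofReal ((1 / 2) *
          ∫ v in Metric.sphere (0 : EuclideanSpace ℝ (Fin 2)) 1,
            (sSup ((fun x => ⟪x, v⟫) '' K) - sInf ((fun x => ⟪x, v⟫) '' K)) ∂μH[1]) := by
  obtain ⟨c, hc⟩ := Crofton.exists_const
  have hmain := Crofton.main_c hcomp hconv hint hc
  rw [Crofton.const_eq hc] at hmain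
  have hne : K.Nonempty := hint.mono interior_subset
  have hnonneg : ∀ v, 0 ≤ Crofton.width K v := fun v =>
    (abs_nonneg _).trans (Crofton.inner_abs_le_width hcomp hne.some_mem hne.some_mem v)
  have hcont := Crofton.width_continuous hcomp
  have hintg : IntegrableOn (Crofton.width K) (Metric.sphere 0 1) μH[1] := by
    obtain ⟨M, hM⟩ := (isCompact_sphere (0 : EuclideanSpace ℝ (Fin 2)) 1).exists_bound_of_continuousOn
      hcont.continuousOn
    refine Measure.integrableOn_of_bounded Crofton.sphere_ne_top
      hcont.measurable.aestronglyMeasurable (M := M) ?_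
    exact (ae_restrict_iff' Metric.isClosed_sphere.measurableSet).2 (ae_of_all _ hM)
  change _ = ENNReal.ofReal ((1 / 2) * ∫ v in Metric.sphere 0 1, Crofton.width K v ∂μH[1])
  rw [ENNReal.ofReal_mul (by norm_num), ofReal_integral_eq_lintegral_ofReal hintg
    (ae_of_all _ hnonneg)]
  have h2 : ENNReal.ofReal (1 / 2) = 2⁻¹ := by
    rw [one_div, ENNReal.ofReal_inv_of_pos (by norm_num)]; simp
  rw [h2]
  have h4 : (4 : ENNReal) = 2 * 2 := by norm_num
  rw [h4, mul_assoc] at hmain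
  have h5 := (ENNReal.mul_right_inj (by norm_num) (by norm_num)).1 hmain
  rw [← h5, ← mul_assoc, ENNReal.inv_mul_cancel (by norm_num) (by norm_num), one_mul]
end
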